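/- arXiv:1909.07135 — 2 statements merged into one kernel-verified Lean document; each statement's English description precedes it below -/
import Mathlib

section
/- Let (A, σ) be a finite-dimensional K-algebra with involution over a field K of characteristic ≠ 2, and let n, m ∈ ℕ. If the involutions n×σ on M_n(A) and m×σ on M_m(A) are both hyperbolic, then the involution gcd(n, m)×σ on M_{gcd(n,m)}(A) is hyperbolic. -/
open Module

/-- The involution `n × σ` on `Mₙ(A)` is hyperbolic: there is an idempotent `e` with
`e^{n×σ} + e = 1`, where `(n×σ)(e) = (σ (e j i))_{i j}`. -/
def MatrixInvolutionHyperbolic {A : Type*} [Ring A] (σ : A → A) (n : ℕ) : Prop :=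
  ∃ e : Matrix (Fin n) (Fin n) A, e * e = e ∧
    (Matrix.of fun i j => σ (e j i)) + e = 1


/-- Orthogonal of a left ideal. -/
def perpIdeal {S : Type*} [Ring S] [StarRing S] (X : Ideal S) : Ideal S where
  carrier := {v | ∀ x ∈ X, v * star x = 0}
  add_mem' := by
    intro a b ha hb x hx
    rw [add_mul, ha x hx, hb x hx, add_zero]
  zero_mem' := by
    intro x _
    exact zero_mul _
  smul_mem' := by
    intro c a ha x hx
    rw [smul_eq_mul, mul_assoc, ha x hx, mul_zero]

theorem mem_perpIdeal {S : Type*} [Ring S] [StarRing S] {X : Ideal S} {v : S} :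
    v ∈ perpIdeal X ↔ ∀ x ∈ X, v * star x = 0 := Iff.rfl

theorem mem_span_idem {S : Type*} [Ring S] {p : S} (hp : p * p = p) {v : S} :
    v ∈ Ideal.span {p} ↔ v * p = v := by
  rw [Ideal.mem_span_singleton']
  constructor
  · rintro ⟨a, rfl⟩
    rw [mul_assoc, hp]
  · intro h
    exact ⟨v, h⟩

theorem mem_perp_span {S : Type*} [Ring S] [StarRing S] {p : S} {v : S} :
    v ∈ perpIdeal (Ideal.span {p}) ↔ v * star p = 0 := by
  rw [mem_perpIdeal]
  constructor
  · intro h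
    exact h p (Ideal.mem_span_singleton_self p)
  · intro h x hx
    obtain ⟨a, rfl⟩ := Ideal.mem_span_singleton'.1 hx
    rw [star_mul, ← mul_assoc, h, zero_mul]

theorem perp_span {S : Type*} [Ring S] [StarRing S] {p : S} (hp : p * p = p) :
    perpIdeal (Ideal.span {p}) = Ideal.span {1 - star p} := by
  have hp' : star p * star p = star p := by rw [← star_mul, hp]
  ext v
  rw [mem_perp_span, mem_span_idem (by simp [mul_sub, sub_mul, hp']), mul_sub, mul_one,
    sub_eq_self]

theorem perp_perp {S : Type*} [Ring S] [StarRing S] [IsSemisimpleRing S] (X : Ideal S) :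
    perpIdeal (perpIdeal X) = X := by
  obtain ⟨p, hp, rfl⟩ := IsSemisimpleRing.ideal_eq_span_idempotent X
  have hp : p * p = p := hp
  have hp' : star p * star p = star p := by rw [← star_mul, hp]
  rw [perp_span hp, perp_span (by simp [mul_sub, sub_mul, hp'])]
  simp

theorem perp_sup {S : Type*} [Ring S] [StarRing S] (X Y : Ideal S) :
    perpIdeal (X ⊔ Y) = perpIdeal X ⊓ perpIdeal Y := by
  ext v
  simp only [Submodule.mem_inf, mem_perpIdeal]
  constructor
  · intro h
    exact ⟨fun x hx => h x (Submodule.mem_sup_left hx), fun x hx => h x (Submodule.mem_sup_right hx)⟩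
  · rintro ⟨h1, h2⟩ x hx
    obtain ⟨y, hy, z, hz, rfl⟩ := Submodule.mem_sup.1 hx
    rw [star_add, mul_add, h1 y hy, h2 z hz, add_zero]

theorem semisimple_cancel {S : Type*} [Ring S] [StarRing S] [IsSemisimpleRing S]
    (h : S) (hh : h + h = 1) (hc : ∀ x, h * x = x * h) (hs : star h = h)
    (f e g : S) (hf : f * f = f) (hfs : star f = f)
    (he : e * e = e) (hes : star e + e = 1)
    (hg : g * g = g) (hgf : g * f = 0) (hgs : star g + g = 1 - f) :
    ∃ p : S, p * p = p ∧ star p + p = f ∧ f * p = p ∧ p * f = p := by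
  let M : Ideal S := Ideal.span {e}
  let N : Ideal S := Ideal.span {g}
  have hM : perpIdeal M = M := by
    show perpIdeal (Ideal.span {e}) = Ideal.span {e}
    rw [perp_span he, ← hes, add_sub_cancel_left]
  have hgs' : star g = 1 - f - g := by rw [← hgs]; abel
  have hNN : N ≤ perpIdeal N := by
    intro x hx
    have hx := (mem_span_idem hg).1 hx
    refine mem_perp_span.2 ?_
    rw [hgs', ← hx]
    simp [mul_sub, mul_assoc, hg, hgf]
  let L : Ideal S := (M ⊓ perpIdeal N) ⊔ N
  have hL : perpIdeal L = L := by
    have h1 : perpIdeal (M ⊓ perpIdeal N) = M ⊔ N := by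
      rw [← perp_perp (M ⊔ N), perp_sup, hM]
    show perpIdeal ((M ⊓ perpIdeal N) ⊔ N) = (M ⊓ perpIdeal N) ⊔ N
    rw [perp_sup, h1, sup_comm M N, sup_inf_assoc_of_le M hNN, sup_comm]
  have hLf : ∀ x ∈ L, x * f ∈ L := by
    intro x hx
    have hxN : x ∈ perpIdeal N := by
      have : L ≤ perpIdeal N := sup_le inf_le_right hNN
      exact this hx
    have h0 : x * star g = 0 := mem_perp_span.1 hxN
    have : x * f = x - x * g := by
      rw [hgs', mul_sub, mul_sub, mul_one, sub_sub, sub_eq_zero] at h0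
      rw [eq_sub_iff_add_eq, ← h0]
    rw [this]
    refine L.sub_mem hx ?_
    exact Submodule.mem_sup_right (N.mul_mem_left x (Ideal.mem_span_singleton_self g))
  let Q : Ideal S := L ⊓ Ideal.span {f}
  obtain ⟨q, hq, hQ⟩ := IsSemisimpleRing.ideal_eq_span_idempotent Q
  have hq : q * q = q := hq
  have memQ : ∀ x, x ∈ L → x * f = x → x * q = x := by
    intro x h1 h2
    have : x ∈ Q := ⟨h1, (mem_span_idem hf).2 h2⟩
    rw [hQ] at this
    exact (mem_span_idem hq).1 this
  have hqQ : q ∈ Q := by rw [hQ]; exact Ideal.mem_span_singleton_self q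
  have hqf : q * f = q := (mem_span_idem hf).1 hqQ.2
  have hqL : q ∈ L := hqQ.1
  have hqq : q * star q = 0 := by
    have : q ∈ perpIdeal L := by rw [hL]; exact hqL
    exact this q hqL
  obtain ⟨p, hp⟩ : ∃ p, p = f * q := ⟨_, rfl⟩
  have hpp : p * p = p := by
    rw [hp, mul_assoc, ← mul_assoc q f q, hqf, hq]
  have hfp : f * p = p := by rw [hp, ← mul_assoc, hf]
  have hpf : p * f = p := by rw [hp, mul_assoc, hqf]
  have hps : p * star p = 0 := by
    rw [hp, star_mul, mul_assoc, ← mul_assoc q, hqq, zero_mul, mul_zero]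
  have hspf : star p * f = star p := by
    conv_rhs => rw [← hfp, star_mul, hfs]
  have hfsp : f * star p = star p := by
    conv_rhs => rw [← hpf, star_mul, hfs]
  have hspp : star p * star p = star p := by rw [← star_mul, hpp]
  have hmem : f - star p ∈ L := by
    rw [← hL]
    intro x hx
    have h1 : x * f * q = x * f := memQ _ (hLf x hx) (by rw [mul_assoc, hf])
    have h2 : x * (f - p) = 0 := by
      rw [mul_sub, hp, ← mul_assoc, h1, sub_self]
    have h3 := congrArg star h2
    simpa [hfs] using h3
  have h4 : (f - star p) * q = f - star p := memQ _ hmem (by rw [sub_mul, hf, hspf])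
  have h5 : p - star p * p = f - star p := by
    have h6 : star p * p = star p * q := by
      nth_rewrite 2 [hp]
      rw [← mul_assoc, hspf]
    rw [h6, ← h4, sub_mul, ← hp]
  have a1 : p * (star p * p) = 0 := by rw [← mul_assoc, hps, zero_mul]
  have a2 : star p * p * p = star p * p := by rw [mul_assoc, hpp]
  have a3 : star p * p * (star p * p) = 0 := by rw [mul_assoc, a1, mul_zero]
  obtain ⟨t, ht⟩ : ∃ t, t = star p * p := ⟨_, rfl⟩
  rw [← ht] at a1 a2 a3 h5
  have hts : star t = t := by rw [ht]; simp
  have hft : f * t = t := by rw [ht, ← mul_assoc, hfsp]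
  have htf : t * f = t := by rw [ht, mul_assoc, hpf]
  have hht : h * t + h * t = t := by rw [← add_mul, hh, one_mul]
  refine ⟨p - h * t, ?_, ?_, ?_, ?_⟩
  · have b1 : p * (h * t) = 0 := by rw [← mul_assoc, ← hc, mul_assoc, a1, mul_zero]
    have b2 : h * t * p = h * t := by rw [mul_assoc, a2]
    have b3 : h * t * (h * t) = 0 := by
      rw [mul_assoc, ← mul_assoc t, ← hc t, mul_assoc h t t, a3, mul_zero, mul_zero]
    rw [mul_sub, sub_mul, sub_mul, hpp, b1, b2, b3]; abel
  · rw [star_sub, star_mul, hts, hs, ← hc]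
    have : f = p + star p - t := by
      rw [← sub_eq_zero]
      have := sub_eq_zero.2 h5
      rw [← neg_eq_zero, ← this]; abel
    rw [this]
    nth_rewrite 3 [← hht]
    abel
  · rw [mul_sub, hfp, ← mul_assoc, ← hc, mul_assoc, hft]
  · rw [sub_mul, hpf, mul_assoc, htf]

theorem hc' {R : Type*} [Ring R] (h : R) (hc : ∀ x, h * x = x * h) (x : R) :
    h * h * x = x * (h * h) := by
  rw [mul_assoc, hc x, ← mul_assoc, hc x, mul_assoc]

theorem newton_lift {R : Type*} [Ring R] [StarRing R]
    (h : R) (hh : h + h = 1) (hc : ∀ x, h * x = x * h) (hs : star h = h)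
    (f : R) (hf : f * f = f) (hfs : star f = f) (j : ℕ) :
    ∀ u : R, star u = -u → f * u = u → u * f = u → (f - u * u) ^ (2 ^ j) = 0 →
      ∃ v : R, star v = -v ∧ f * v = v ∧ v * f = v ∧ v * v = f := by
  induction j with
  | zero =>
    intro u h1 h2 h3 h4
    rw [pow_zero, pow_one, sub_eq_zero] at h4
    exact ⟨u, h1, h2, h3, h4.symm⟩
  | succ j ih =>
    intro u h1 h2 h3 h4
    obtain ⟨N, hN⟩ : ∃ N, N = f - u * u := ⟨_, rfl⟩
    rw [← hN] at h4
    have huN : u * N = N * u := by rw [hN, mul_sub, sub_mul, h2, h3, mul_assoc]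
    have hfN : f * N = N := by rw [hN, mul_sub, hf, ← mul_assoc, h2]
    have hNf : N * f = N := by rw [hN, sub_mul, hf, mul_assoc, h3]
    have hsN : star N = N := by rw [hN]; simp [h1, hfs]
    have huu : u * u = f - N := by rw [hN]; abel
    have key : f - (u + h * (u * N)) * (u + h * (u * N)) = (N * N) * (1 - h * h + h * h * N) := by
      have c1 : u * (h * (u * N)) = h * (N - N * N) := by
        rw [← mul_assoc, ← hc, mul_assoc, ← mul_assoc u u, huu, sub_mul, hfN]
      have c2 : h * (u * N) * u = h * (N - N * N) := by
        rw [mul_assoc, mul_assoc, ← huN, ← mul_assoc u u, huu, sub_mul, hfN]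
      have c3 : h * (u * N) * (h * (u * N)) = h * h * (N * N - N * N * N) := by
        rw [mul_assoc, ← mul_assoc (u * N), ← hc (u * N), mul_assoc h (u * N), ← mul_assoc h h]
        congr 1
        calc u * N * (u * N) = N * u * (u * N) := by rw [huN]
          _ = N * (u * u) * N := by simp only [mul_assoc]
          _ = N * N - N * N * N := by rw [huu, mul_sub, hNf, sub_mul]
      have c4 : h * (N - N * N) + h * (N - N * N) = N - N * N := by
        rw [← add_mul, hh, one_mul]
      have c5 : (N * N) * (h * h) = h * h * (N * N) := (hc' h hc (N * N)).symm
      have c6 : (u + h * (u * N)) * (u + h * (u * N)) =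
          u * u + (h * (N - N * N) + h * (N - N * N)) + h * h * (N * N - N * N * N) := by
        rw [mul_add, add_mul, add_mul, c1, c2, c3]; abel
      rw [c6, c4, huu, mul_add (N * N), mul_sub (N * N), mul_one, c5, ← mul_assoc (N * N), c5,
        mul_sub (h * h), mul_assoc (h * h) (N * N) N]
      abel
    refine ih (u + h * (u * N)) ?_ ?_ ?_ ?_
    · rw [star_add, star_mul, star_mul, hs, hsN, h1, ← hc, mul_neg, huN, mul_neg]; abel
    · rw [mul_add, h2, ← mul_assoc, ← hc, mul_assoc, ← mul_assoc f, h2]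
    · rw [add_mul, h3, mul_assoc, mul_assoc, hNf]
    · rw [key]
      have hcomm : Commute (N * N) (1 - h * h + h * h * N) := by
        have ch : Commute N h := (hc N).symm
        have cN : Commute N N := Commute.refl N
        have : Commute N (1 - h * h + h * h * N) :=
          ((Commute.one_right N).sub_right (ch.mul_right ch)).add_right
            ((ch.mul_right ch).mul_right cN)
        exact this.mul_left this
      rw [hcomm.mul_pow, ← pow_two N, ← pow_mul, ← pow_succ', h4, zero_mul]

theorem artinian_cancel {R : Type*} [Ring R] [StarRing R] [IsArtinianRing R]
    (h : R) (hh : h + h = 1) (hc : ∀ x, h * x = x * h) (hs : star h = h)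
    (f e g : R) (hf : f * f = f) (hfs : star f = f)
    (he : e * e = e) (hes : star e + e = 1)
    (hg : g * g = g) (hgf : g * f = 0) (hgs : star g + g = 1 - f) :
    ∃ p : R, p * p = p ∧ star p + p = f ∧ f * p = p ∧ p * f = p := by
  let J : Ideal R := Ring.jacobson R
  obtain ⟨k, hk⟩ : IsNilpotent J := IsSemiprimaryRing.isNilpotent
  have hnil : ∀ x ∈ J, x ^ k = 0 := by
    intro x hx
    have : x ^ k ∈ J ^ k := Ideal.pow_mem_pow hx k
    rw [hk] at this
    exact this
  have hJs : ∀ x ∈ J, star x ∈ J := by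
    intro x hx
    show star x ∈ Ring.jacobson R
    rw [← Ideal.jacobson_bot, Ideal.mem_jacobson_iff]
    intro y
    have h1 : x * star y ∈ J := Ideal.mul_mem_right _ _ hx
    have h2 : IsNilpotent (y * star x) := by
      refine ⟨k, ?_⟩
      have h3 := congrArg star (hnil _ h1)
      simpa using h3
    obtain ⟨w, hw⟩ := h2.isUnit_one_add
    refine ⟨↑w⁻¹, ?_⟩
    have : (↑w⁻¹ : R) * (1 + y * star x) = 1 := by rw [← hw]; simp
    rw [Ideal.mem_bot, sub_eq_zero, mul_assoc, ← this]
    rw [mul_add, mul_one, add_comm]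
  let φ : R →+* (R ⧸ J)ᵐᵒᵖ :=
    (RingHom.op (Ideal.Quotient.mk J)).comp (starRingEquiv : R ≃+* Rᵐᵒᵖ).toRingHom
  let ψ : R ⧸ J →+* (R ⧸ J)ᵐᵒᵖ := Ideal.Quotient.lift J φ (by
    intro a ha
    show MulOpposite.op (Ideal.Quotient.mk J (star a)) = 0
    rw [Ideal.Quotient.eq_zero_iff_mem.2 (hJs a ha)]; rfl)
  let π : R →+* R ⧸ J := Ideal.Quotient.mk J
  have hψ : ∀ a, (ψ (π a)).unop = π (star a) := fun a => rfl
  have hsurj : Function.Surjective π := Ideal.Quotient.mk_surjective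
  letI : StarRing (R ⧸ J) :=
    { star := fun x => (ψ x).unop
      star_involutive := by
        intro x
        obtain ⟨a, rfl⟩ := hsurj x
        show (ψ (ψ (π a)).unop).unop = π a
        rw [hψ, hψ, star_star]
      star_mul := by
        intro x y
        show (ψ (x * y)).unop = _
        rw [map_mul]; rfl
      star_add := by
        intro x y
        show (ψ (x + y)).unop = _
        rw [map_add]; rfl }
  have hπs : ∀ a, star (π a) = π (star a) := hψ
  haveI : IsSemisimpleRing (R ⧸ J) := IsSemiprimaryRing.isSemisimpleRing
  obtain ⟨p, hp1, hp2, hp3, hp4⟩ := semisimple_cancel (S := R ⧸ J) (π h)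
    (by rw [← map_add, hh, map_one])
    (by
      intro x
      obtain ⟨a, rfl⟩ := hsurj x
      rw [← map_mul, hc, map_mul]) (by rw [hπs, hs]) (π f) (π e) (π g)
    (by rw [← map_mul, hf]) (by rw [hπs, hfs]) (by rw [← map_mul, he])
    (by rw [hπs, ← map_add, hes, map_one]) (by rw [← map_mul, hg])
    (by rw [← map_mul, hgf, map_zero]) (by rw [hπs, ← map_add, hgs, map_sub, map_one])
  obtain ⟨y, rfl⟩ := hsurj p
  obtain ⟨x, hx⟩ : ∃ x, x = f * y * f + f * y * f - f := ⟨_, rfl⟩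
  have hfx : f * x = x := by simp only [hx, mul_sub, mul_add, ← mul_assoc, hf]
  have hxf : x * f = x := by simp only [hx, sub_mul, add_mul, mul_assoc, hf]
  have hsxf : star x * f = star x := by
    conv_rhs => rw [← hfx, star_mul, hfs]
  have hfsx : f * star x = star x := by
    conv_rhs => rw [← hxf, star_mul, hfs]
  have hπx : π x = π y + π y - π f := by
    rw [hx, map_sub, map_add, map_mul, map_mul, hp3, hp4]
  have hπsx : π (star x) = - π x := by
    rw [← hπs, hπx, star_sub, star_add]
    have : star (π y) = π f - π y := by rw [← hp2]; abel
    rw [this, hπs, hfs]; abel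
  have hπu : π (h * (x - star x)) = π x := by
    rw [map_mul, map_sub, hπsx, sub_neg_eq_add, mul_add, ← add_mul, ← map_add, hh, map_one,
      one_mul]
  have hmemJ : f - h * (x - star x) * (h * (x - star x)) ∈ J := by
    rw [← Ideal.Quotient.eq_zero_iff_mem]
    show π _ = 0
    rw [map_sub, map_mul, hπu, hπx]
    have d1 : π f * π f = π f := by rw [← map_mul, hf]
    simp only [mul_sub, sub_mul, mul_add, add_mul, hp1, hp3, hp4, d1]
    abel
  obtain ⟨v, hv1, hv2, hv3, hv4⟩ := newton_lift h hh hc hs f hf hfs k (h * (x - star x))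
    (by rw [star_mul, hs, ← hc, ← mul_neg]; simp)
    (by rw [← mul_assoc, ← hc, mul_assoc, mul_sub, hfx, hfsx])
    (by rw [mul_assoc, sub_mul, hxf, hsxf])
    (by
      obtain ⟨c, hc⟩ := Nat.exists_eq_add_of_le (Nat.lt_two_pow_self (n := k)).le
      rw [hc, pow_add, hnil _ hmemJ, zero_mul])
  refine ⟨h * (f + v), ?_, ?_, ?_, ?_⟩
  · have : (f + v) * (f + v) = (f + v) + (f + v) := by
      rw [mul_add, add_mul, add_mul, hf, hv2, hv3, hv4]; abel
    rw [mul_assoc, ← mul_assoc (f + v), ← hc (f + v), mul_assoc h, this, mul_add h, ← add_mul, hh,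
      one_mul]
  · rw [star_mul, hs, ← hc, ← mul_add, star_add, hfs, hv1]
    have : f + -v + (f + v) = f + f := by abel
    rw [this, mul_add, ← add_mul, hh, one_mul]
  · rw [← mul_assoc, ← hc, mul_assoc, mul_add, hf, hv2]
  · rw [mul_assoc, add_mul, hf, hv3]

theorem hyperbolic_sub {A : Type*} [Ring A] [StarRing A] [IsArtinianRing A]
    (h : A) (hh : h + h = 1) (hc : ∀ x, h * x = x * h) (hs : star h = h) (d m : ℕ)
    (hm : MatrixInvolutionHyperbolic (star : A → A) m)
    (hn : MatrixInvolutionHyperbolic (star : A → A) (d + m)) :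
    MatrixInvolutionHyperbolic (star : A → A) d := by
  obtain ⟨g, hg, hgs⟩ := hm
  obtain ⟨e, he, hes⟩ := hn
  have hgs : star g + g = 1 := hgs
  have hes : star e + e = 1 := hes
  let E : Matrix (Fin d ⊕ Fin m) (Fin d ⊕ Fin m) A := e.submatrix finSumFinEquiv finSumFinEquiv
  obtain ⟨p, hp1, hp2, hp3, hp4⟩ := artinian_cancel
    (R := Matrix (Fin d ⊕ Fin m) (Fin d ⊕ Fin m) A)
    (Matrix.diagonal fun _ => h)
    (by rw [Matrix.diagonal_add, hh, Matrix.diagonal_one])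
    (by intro x; ext i j; simp [hc])
    (by rw [Matrix.star_eq_conjTranspose, Matrix.diagonal_conjTranspose]; congr 1; ext; simp [hs])
    (Matrix.fromBlocks 1 0 0 0) E (Matrix.fromBlocks 0 0 0 g)
    (by simp [Matrix.fromBlocks_multiply])
    (by simp [Matrix.star_eq_conjTranspose, Matrix.fromBlocks_conjTranspose])
    (by
      show e.submatrix finSumFinEquiv finSumFinEquiv * e.submatrix finSumFinEquiv finSumFinEquiv = _
      rw [Matrix.submatrix_mul_equiv, he])
    (by
      have := congrArg (fun M => M.submatrix (finSumFinEquiv (m := d) (n := m)) finSumFinEquiv) hes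
      simp only [Matrix.submatrix_add, Matrix.submatrix_one_equiv] at this
      exact this)
    (by simp [Matrix.fromBlocks_multiply, hg])
    (by simp [Matrix.fromBlocks_multiply])
    (by
      rw [Matrix.star_eq_conjTranspose] at hgs ⊢
      rw [Matrix.fromBlocks_conjTranspose, Matrix.fromBlocks_add, hgs, ← Matrix.fromBlocks_one,
        sub_eq_add_neg, Matrix.fromBlocks_neg, Matrix.fromBlocks_add]
      simp)
  obtain ⟨a, b, c, k, rfl⟩ : ∃ a b c k, p = Matrix.fromBlocks a b c k :=
    ⟨_, _, _, _, (Matrix.fromBlocks_toBlocks p).symm⟩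
  rw [Matrix.star_eq_conjTranspose, Matrix.fromBlocks_conjTranspose, Matrix.fromBlocks_add,
    Matrix.fromBlocks_inj] at hp2
  rw [Matrix.fromBlocks_multiply, Matrix.fromBlocks_inj] at hp1 hp3 hp4
  have hc0 : c = 0 := by have := hp3.2.2.1; simpa using this.symm
  refine ⟨a, ?_, hp2.1⟩
  have := hp1.1
  rwa [hc0, Matrix.mul_zero, add_zero] at this

theorem gcd_closed (P : ℕ → Prop) (hP : ∀ d m, P m → P (d + m) → P d) (s : ℕ) :
    ∀ n m, n + m ≤ s → P n → P m → P (Nat.gcd n m) := by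
  induction s with
  | zero =>
    intro n m h h1 h2
    obtain ⟨rfl, rfl⟩ : n = 0 ∧ m = 0 := by omega
    simpa using h1
  | succ s ih =>
    intro n m h h1 h2
    rcases Nat.eq_zero_or_pos n with rfl | hn
    · simpa using h2
    rcases Nat.eq_zero_or_pos m with rfl | hm
    · simpa using h1
    rcases le_total n m with hnm | hnm
    · obtain ⟨d, rfl⟩ := Nat.exists_eq_add_of_le' hnm
      have := ih n d (by omega) h1 (hP d n h1 h2)
      simpa using this
    · obtain ⟨d, rfl⟩ := Nat.exists_eq_add_of_le' hnm
      have := ih d m (by omega) (hP d m h2 h1) h2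
      simpa using this

/-- **Corollary.** If `n × σ` and `m × σ` are hyperbolic, then so is `gcd(n,m) × σ`. -/
theorem statement6 {K A : Type*} [Field K] (hchar : (2 : K) ≠ 0)
    [Ring A] [Algebra K A] [FiniteDimensional K A]
    (σ : A → A)
    (hadd : ∀ x y : A, σ (x + y) = σ x + σ y)
    (hsmul : ∀ (c : K) (x : A), σ (c • x) = c • σ x)
    (hmul : ∀ x y : A, σ (x * y) = σ y * σ x)
    (hinvol : ∀ x : A, σ (σ x) = x)
    (n m : ℕ)
    (hn : MatrixInvolutionHyperbolic σ n) (hm : MatrixInvolutionHyperbolic σ m) :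
    MatrixInvolutionHyperbolic σ (Nat.gcd n m) := by
  have h2 : (2⁻¹ : K) + 2⁻¹ = 1 := by field_simp; norm_num
  letI : StarRing A :=
    { star := σ
      star_involutive := hinvol
      star_mul := hmul
      star_add := hadd }
  haveI : IsArtinianRing A := IsArtinianRing.of_finite K A
  have key := hyperbolic_sub (A := A) (algebraMap K A 2⁻¹) (by rw [← map_add, h2, map_one])
    (fun x => Algebra.commutes _ x)
    (by
      rw [Algebra.algebraMap_eq_smul_one]
      show σ _ = _
      rw [hsmul]
      congr 1
      exact star_one A)
  exact gcd_closed (MatrixInvolutionHyperbolic σ) key (n + m) n m le_rfl hn hm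
end

section
/- Let (A, σ) be a finite-dimensional K-algebra with involution over a field K of characteristic ≠ 2, and let q_{A,σ} be its involution-trace form. Then the following are equivalent: (a) n×(A, σ) is hyperbolic for some n ∈ ℕ; (b) sgn_P(q_{A,σ}) = 0 for every ordering P of K. When these conditions hold, the minimal n for which (a) holds is a power of 2. -/
open Module

structure FieldOrdering (K : Type*) [Field K] where
  carrier : Set K
  add_mem' : ∀ ⦃a b : K⦄, a ∈ carrier → b ∈ carrier → a + b ∈ carrier
  mul_mem' : ∀ ⦃a b : K⦄, a ∈ carrier → b ∈ carrier → a * b ∈ carrier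
  total' : ∀ a : K, a ≠ 0 → a ∈ carrier ∨ -a ∈ carrier
  disjoint' : ∀ a : K, a ∈ carrier → -a ∉ carrier

noncomputable def signatureAt {K V : Type*} [Field K] [AddCommGroup V] [Module K V]
    (O : FieldOrdering K) (Q : V → K) : ℤ :=
  (sSup {n : ℕ | ∃ U : Submodule K V, Module.finrank K U = n ∧
      ∀ v ∈ U, v ≠ 0 → Q v ∈ O.carrier} : ℕ) -
  (sSup {n : ℕ | ∃ U : Submodule K V, Module.finrank K U = n ∧
      ∀ v ∈ U, v ≠ 0 → -(Q v) ∈ O.carrier} : ℕ)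

/-- The involution-trace form `q_{A,σ}(x) = Tr_{A/K}(x^σ x)`, where `Tr_{A/K}(a)` is the
trace of left multiplication by `a` on `A`. -/
noncomputable def involutionTraceForm (K : Type*) {A : Type*} [Field K] [Ring A]
    [Algebra K A] (σ : A → A) : A → K :=
  fun x => LinearMap.trace K A (LinearMap.mulLeft K (σ x * x))

section Part1
structure IsInvo {R : Type*} [Ring R] (σ : R → R) : Prop where
  add : ∀ x y, σ (x + y) = σ x + σ y
  mul : ∀ x y, σ (x * y) = σ y * σ x
  inv : ∀ x, σ (σ x) = x

namespace IsInvo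
variable {R : Type*} [Ring R] {σ : R → R} (h : IsInvo σ)
include h

def hom : R →+ R := AddMonoidHom.mk' σ h.add

theorem zero : σ 0 = 0 := h.hom.map_zero
theorem neg (x : R) : σ (-x) = -σ x := h.hom.map_neg x
theorem sub (x y : R) : σ (x - y) = σ x - σ y := h.hom.map_sub x y
theorem sum {ι : Type*} (s : Finset ι) (f : ι → R) : σ (∑ i ∈ s, f i) = ∑ i ∈ s, σ (f i) :=
  map_sum h.hom f s
theorem one : σ 1 = 1 := by
  have := h.mul 1 (σ 1)
  rw [one_mul, h.inv, one_mul] at this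
  exact this.symm
theorem pow (x : R) (n : ℕ) : σ (x ^ n) = σ x ^ n := by
  induction n with
  | zero => simp [h.one]
  | succ n ih => rw [pow_succ, h.mul, ih, pow_succ']
end IsInvo

theorem cancel_semisimple {R : Type*} [Ring R] [IsSemisimpleRing R] {σ : R → R} (h : IsInvo σ)
    {p f g : R} (hp : p * p = p) (hσp : σ p = p) (hf : f * f = f) (hσf : σ f = 1 - f)
    (hg : g * g = g) (hσg : σ g = 1 - p - g) (hpg : p * g = 0) (hgp : g * p = 0) :
    ∃ w : R, p * w = w ∧ w * p = w ∧ w * w = p ∧ σ w = - w := by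
  obtain ⟨e1, he1, hW⟩ := IsSemisimpleRing.ideal_eq_span_idempotent (Ideal.span {f} ⊔ Ideal.span {g})
  have he1 : e1 * e1 = e1 := he1
  -- X ∩ Y
  let Z : Ideal R := Ideal.span {f} ⊓ Ideal.span {p + g}
  let T : R →ₗ[R] R := LinearMap.toSpanSingleton R R p
  have hT : ∀ x, T x = x * p := fun x => rfl
  obtain ⟨e, he, hM⟩ := IsSemisimpleRing.ideal_eq_span_idempotent (Submodule.map T Z)
  have he : e * e = e := he
  have hpgi : (p + g) * (p + g) = p + g := by
    simp [mul_add, add_mul, hp, hg, hpg, hgp]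
  have memf : ∀ x : R, x ∈ Ideal.span {f} ↔ x * f = x := by
    intro x
    rw [Ideal.mem_span_singleton']
    exact ⟨by rintro ⟨a, rfl⟩; rw [mul_assoc, hf], fun hx => ⟨x, hx⟩⟩
  have memy : ∀ x : R, x ∈ Ideal.span {p + g} ↔ x * (p + g) = x := by
    intro x
    rw [Ideal.mem_span_singleton']
    exact ⟨by rintro ⟨a, rfl⟩; rw [mul_assoc, hpgi], fun hx => ⟨x, hx⟩⟩
  have meme : ∀ x : R, x ∈ Submodule.map T Z ↔ x * e = x := by
    intro x
    rw [hM, Ideal.mem_span_singleton']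
    exact ⟨by rintro ⟨a, rfl⟩; rw [mul_assoc, he], fun hx => ⟨x, hx⟩⟩
  have mem1 : ∀ x : R, x ∈ Ideal.span {f} ⊔ Ideal.span {g} ↔ x * e1 = x := by
    intro x
    rw [hW, Ideal.mem_span_singleton']
    exact ⟨by rintro ⟨a, rfl⟩; rw [mul_assoc, he1], fun hx => ⟨x, hx⟩⟩
  have memZ : ∀ x : R, x ∈ Z ↔ x * f = x ∧ x * (p + g) = x := by
    intro x; rw [← memf, ← memy]; rfl
  -- isotropy
  have hee : e * σ e = 0 := by
    obtain ⟨w, hw, hwe⟩ := (meme e).2 he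
    obtain ⟨hw1, hw2⟩ := (memZ w).1 hw
    have a1 : w * σ w = 0 := by
      rw [← hw1, h.mul, hσf]
      have : f * (1 - f) = 0 := by rw [mul_sub, hf]; simp
      rw [mul_assoc, ← mul_assoc f, this]; simp
    have a2 : w * σ w = w * p * σ w := by
      conv_lhs => rw [← hw2, h.mul, h.add, hσp, hσg]
      have : (p + g) * (p + (1 - p - g)) = p := by
        have : p + (1 - p - g) = 1 - g := by abel
        rw [this, mul_sub, mul_one, add_mul, hpg, hg]; abel
      rw [mul_assoc, ← mul_assoc (p + g), this, mul_assoc]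
    have : e = w * p := hwe.symm
    rw [this, h.mul, hσp, mul_assoc, ← mul_assoc p, hp, ← mul_assoc, ← a2, a1]
  have hep : e * p = e := by
    obtain ⟨w, hw, hwe⟩ := (meme e).2 he
    have : e = w * p := hwe.symm
    rw [this, mul_assoc, hp]
  have hZ1 : 1 - σ e1 ∈ Z := by
    rw [memZ]
    have h1 : f * e1 = f := (mem1 f).1 (Ideal.mem_sup_left (Ideal.mem_span_singleton_self f))
    have h2 : g * e1 = g := (mem1 g).1 (Ideal.mem_sup_right (Ideal.mem_span_singleton_self g))
    have h1' := congrArg σ h1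
    have h2' := congrArg σ h2
    rw [h.mul, hσf] at h1'
    rw [h.mul, hσg] at h2'
    constructor
    · have : σ e1 * f = σ e1 - 1 + f := by
        have := h1'
        rw [mul_sub, mul_one] at this
        rw [← sub_eq_zero] at this ⊢
        rw [← neg_eq_zero, ← this]; abel
      rw [sub_mul, this]; simp
    · have : σ e1 * (p + g) = σ e1 - 1 + (p + g) := by
        have := h2'
        rw [sub_sub, mul_sub, mul_one] at this
        rw [← sub_eq_zero] at this ⊢
        rw [← neg_eq_zero, ← this]; abel
      rw [sub_mul, this]; simp
  have key : ∀ z : R, z * p = z → z * σ e = 0 → z * e = z := by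
    intro z hzp hze
    have a1 : z * (1 - e1) = 0 := by
      have : (1 - σ e1) * p * e = (1 - σ e1) * p :=
        (meme _).1 ⟨_, hZ1, hT _⟩
      have := congrArg σ this
      rw [h.mul, h.mul, h.sub, h.inv, h.one, hσp] at this
      have h3 := congrArg (z * ·) this
      simp only [← mul_assoc, hze, zero_mul, hzp] at h3
      exact h3.symm
    have a2 : z ∈ Ideal.span {f} ⊔ Ideal.span {g} := by
      rw [mem1, eq_comm, ← sub_eq_zero, ← a1, mul_sub, mul_one]
    obtain ⟨a, ha, b, hb, hab⟩ := Submodule.mem_sup.1 a2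
    rw [Ideal.mem_span_singleton'] at hb
    obtain ⟨b, rfl⟩ := hb
    rw [← meme]
    refine ⟨a, (memZ a).2 ⟨(memf a).1 ha, ?_⟩, ?_⟩
    · have : a = z - b * g := by rw [← hab]; abel
      have hzg : z * g = 0 := by rw [← hzp, mul_assoc, hpg, mul_zero]
      rw [this, sub_mul, mul_add, hzp, hzg, mul_assoc, mul_add, hgp, hg]; simp
    · rw [hT]
      have : a = z - b * g := by rw [← hab]; abel
      rw [this, sub_mul, hzp, mul_assoc, hgp]; simp
  have hσe : p * σ e = σ e := by
    have := congrArg σ hep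
    rwa [h.mul, hσp] at this
  have hσee : σ e * σ e = σ e := by rw [← h.mul, he]
  have hz := key (p - σ e * p) (by rw [sub_mul, mul_assoc, hp]) (by
    rw [sub_mul, mul_assoc, hσe, hσee, sub_self])
  have s1 : σ (p * e) = σ e * p := by rw [h.mul, hσp]
  have idem : p * e * (p * e) = p * e := by rw [mul_assoc, ← mul_assoc e, hep, he]
  refine ⟨p * e - σ e * p, ?_, ?_, ?_, ?_⟩
  · rw [mul_sub, ← mul_assoc, hp, ← mul_assoc, hσe]
  · rw [sub_mul, mul_assoc, hep, mul_assoc, hp]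
  · have t1 : p * e * (σ e * p) = 0 := by
      rw [mul_assoc, ← mul_assoc e, hee]; simp
    have t2 : σ e * p * (σ e * p) = σ e * p := by
      rw [mul_assoc, ← mul_assoc p, hσe, ← mul_assoc, hσee]
    have t3 : σ e * p * (p * e) = σ e * p * e := by
      rw [mul_assoc, ← mul_assoc p, hp, mul_assoc]
    rw [sub_mul] at hz
    rw [sub_mul, mul_sub, mul_sub, idem, t1, t2, t3]
    have : p * e = p - σ e * p + σ e * p * e := by rw [← hz]; abel
    rw [this]; abel
  · rw [h.sub, s1, h.mul, h.inv, hσp]; abel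
end Part1

section Part2
universe u
theorem exists_semisimple_quot {K : Type*} {R : Type u} [Field K] [Ring R] [Algebra K R]
    [FiniteDimensional K R] {σ : R → R} (h : IsInvo σ) (hs : ∀ (c : K) x, σ (c • x) = c • σ x) :
    ∃ (S : Type u) (_ : Ring S) (_ : Algebra K S) (_ : FiniteDimensional K S)
      (_ : IsSemisimpleRing S) (π : R →ₐ[K] S) (σ' : S → S), IsInvo σ' ∧
      (∀ (c : K) x, σ' (c • x) = c • σ' x) ∧ Function.Surjective π ∧
      (∀ x, σ' (π x) = π (σ x)) ∧ (∀ x, π x = 0 → IsNilpotent x) := by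
  have : IsArtinianRing R := IsArtinianRing.of_finite K R
  obtain ⟨n, hn⟩ := IsSemiprimaryRing.isNilpotent (R := R)
  have hnil : ∀ x ∈ Ring.jacobson R, IsNilpotent x := by
    intro x hx
    refine ⟨n, ?_⟩
    have := Ideal.pow_mem_pow hx n
    rw [hn] at this
    simpa using this
  have hJ : ∀ x ∈ Ring.jacobson R, σ x ∈ Ring.jacobson R := by
    intro x hx
    rw [← Ideal.jacobson_bot, Ideal.mem_jacobson_iff]
    intro y
    have h1 : x * σ y ∈ Ring.jacobson R := Ideal.mul_mem_right _ _ hx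
    have h2 : IsNilpotent (y * σ x) := by
      obtain ⟨m, hm⟩ := hnil _ h1
      refine ⟨m, ?_⟩
      have := congrArg σ hm
      rw [h.pow, h.mul, h.inv, h.zero] at this
      exact this
    obtain ⟨u, hu⟩ := h2.isUnit_add_one
    refine ⟨↑u⁻¹, ?_⟩
    have := u.inv_mul
    rw [hu] at this
    rw [Ideal.mem_bot, mul_assoc]
    rw [mul_add, mul_one] at this
    rw [this, sub_self]
  let J := Ring.jacobson R
  let π : R →ₐ[K] R ⧸ J := Ideal.Quotient.mkₐ K J
  have hπ : Function.Surjective π := Ideal.Quotient.mkₐ_surjective K J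
  have hker : ∀ x, π x = 0 ↔ x ∈ J := fun x => Ideal.Quotient.eq_zero_iff_mem
  let s := Function.surjInv hπ
  have hs' : ∀ x, π (s x) = x := Function.surjInv_eq hπ
  let σ' : R ⧸ J → R ⧸ J := fun x => π (σ (s x))
  have hc : ∀ x, σ' (π x) = π (σ x) := by
    intro x
    change π (σ (s (π x))) = π (σ x)
    rw [← sub_eq_zero, ← map_sub, ← h.sub, hker]
    apply hJ
    rw [← hker, map_sub, hs', sub_self]
  refine ⟨R ⧸ J, inferInstance, inferInstance, ?_, IsSemiprimaryRing.isSemisimpleRing, π, σ', ?_, ?_, hπ, hc, ?_⟩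
  · exact Module.Finite.of_surjective π.toLinearMap hπ
  · constructor
    · intro x y
      obtain ⟨x, rfl⟩ := hπ x
      obtain ⟨y, rfl⟩ := hπ y
      rw [← map_add, hc, hc, hc, h.add, map_add]
    · intro x y
      obtain ⟨x, rfl⟩ := hπ x
      obtain ⟨y, rfl⟩ := hπ y
      rw [← map_mul, hc, hc, hc, h.mul, map_mul]
    · intro x
      obtain ⟨x, rfl⟩ := hπ x
      have e1 : σ' (σ' (π x)) = σ' (π (σ x)) := congrArg σ' (hc x)
      rw [e1, hc, h.inv]
  · intro c x
    obtain ⟨x, rfl⟩ := hπ x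
    rw [← map_smul, hc, hc, hs, map_smul]
  · intro x hx
    exact hnil x ((hker x).1 hx)

open Polynomial in
theorem exists_invsqrt {K : Type*} [Field K] (h2 : (2 : K) ≠ 0) (n : ℕ) :
    ∃ g : K[X], X ^ (n + 1) ∣ g ^ 2 * (1 + X) - 1 := by
  induction n with
  | zero => exact ⟨1, by simp⟩
  | succ n ih =>
    obtain ⟨g, r, hr⟩ := ih
    refine ⟨g * (1 - C (1/2) * (X ^ (n+1) * r)), ?_⟩
    have hh : (C (1/2 : K)) * 2 = 1 := by
      rw [show (2 : K[X]) = C 2 from rfl, ← C_mul]; simp [h2]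
    have e : g ^ 2 * (1 + X) = 1 + X ^ (n+1) * r := by rw [← hr]; ring
    have e2 : (g * (1 - C (1/2) * (X ^ (n+1) * r))) ^ 2 * (1 + X) - 1 =
      X ^ (n + 1 + 1) * (X ^ n * r ^ 2 * (C (1/2) ^ 2 * (1 + X ^ (n+1) * r) - 1)) := by
      have : (g * (1 - C (1/2) * (X ^ (n+1) * r))) ^ 2 * (1 + X) - 1 =
        (g ^ 2 * (1 + X)) * (1 - C (1/2) * (X ^ (n+1) * r)) ^ 2 - 1 := by ring
      rw [this, e]
      have : (1 + X ^ (n+1) * r) * (1 - C (1/2) * (X ^ (n+1) * r)) ^ 2 - 1 =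
        (X ^ (n+1) * r) * (1 - C (1/2) * 2) - C (1/2) * 2 * (X ^ (n+1) * r) ^ 2
        + C (1/2) ^ 2 * (X ^ (n+1) * r) ^ 2 * (1 + X ^ (n+1) * r)  := by ring
      rw [this, hh]
      ring
    exact ⟨_, e2⟩

theorem exists_invsqrt' {K R : Type*} [Field K] [Ring R] [Algebra K R] (h2 : (2 : K) ≠ 0) {j : R}
    (hj : IsNilpotent j) :
    ∃ g : Polynomial K, (Polynomial.aeval j g) ^ 2 * (1 + j) = 1 := by
  obtain ⟨n, hn⟩ := hj
  obtain ⟨g, r, hr⟩ := exists_invsqrt h2 n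
  refine ⟨g, ?_⟩
  have := congrArg (Polynomial.aeval j) hr
  simp only [map_sub, map_mul, map_pow, map_add, map_one, Polynomial.aeval_X, pow_succ j n, hn,
    zero_mul] at this
  rw [sub_eq_zero] at this
  exact this

theorem IsInvo.aeval {K R : Type*} [Field K] [Ring R] [Algebra K R] {σ : R → R} (h : IsInvo σ)
    (hs : ∀ (c : K) x, σ (c • x) = c • σ x) (g : Polynomial K) (x : R) :
    σ (Polynomial.aeval x g) = Polynomial.aeval (σ x) g := by
  induction g using Polynomial.induction_on' with
  | add p q hp hq => rw [map_add, h.add, hp, hq, map_add]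
  | monomial n a =>
    rw [Polynomial.aeval_monomial, Polynomial.aeval_monomial, ← Algebra.smul_def,
      ← Algebra.smul_def, hs, h.pow]

theorem commute_aeval_r {K R : Type*} [Field K] [Ring R] [Algebra K R] (g : Polynomial K) {x y : R}
    (h : Commute x y) : Commute x (Polynomial.aeval y g) := by
  induction g using Polynomial.induction_on' with
  | add p q hp hq => rw [map_add]; exact hp.add_right hq
  | monomial n a =>
    rw [Polynomial.aeval_monomial, ← Algebra.smul_def]
    exact (h.pow_right n).smul_right a

/-- lifting a skew square root of a symmetric idempotent -/
theorem lift_skew {K R S : Type*} [Field K] (h2 : (2 : K) ≠ 0) [Ring R] [Algebra K R] [Ring S]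
    [Algebra K S] {σ : R → R} (h : IsInvo σ) (hs : ∀ (c : K) x, σ (c • x) = c • σ x)
    {σ' : S → S} (π : R →ₐ[K] S) (hπ : Function.Surjective π) (hc : ∀ x, σ' (π x) = π (σ x))
    (hnil : ∀ x, π x = 0 → IsNilpotent x) {p : R} (hp : p * p = p) (hσp : σ p = p)
    {w : S} (hpw : π p * w = w) (hwp : w * π p = w) (hw : w * w = π p) (hσw : σ' w = - w) :
    ∃ v : R, p * v = v ∧ v * p = v ∧ v * v = p ∧ σ v = - v := by
  obtain ⟨w0, rfl⟩ := hπ w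
  let w1 : R := (1/2 : K) • (p * (w0 - σ w0) * p)
  have half : ∀ x : S, (1/2 : K) • (x + x) = x := by
    intro x; rw [← two_smul K x, smul_smul]; simp [h2]
  have hw1 : π w1 = π w0 := by
    simp only [w1, map_smul, map_mul, map_sub, ← hc, hσw, sub_neg_eq_add]
    rw [mul_add, hpw, add_mul, hwp, half]
  have a1 : p * w1 = w1 := by
    simp only [w1, mul_smul_comm, ← mul_assoc, hp]
  have a2 : w1 * p = w1 := by
    simp only [w1, smul_mul_assoc, mul_assoc, hp]
  have a3 : σ w1 = - w1 := by
    simp only [w1, hs, h.mul, h.sub, h.inv, hσp]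
    rw [← smul_neg]; congr 1
    rw [← mul_assoc, ← neg_mul, ← mul_neg]; congr 2; abel
  let j := w1 * w1 - p
  have hj : IsNilpotent j := hnil _ (by
    simp only [j, map_sub, map_mul, hw1, hw, sub_self])
  have hpj : p * j = j := by simp only [j, mul_sub, hp, ← mul_assoc, a1]
  have hjp : j * p = j := by simp only [j, sub_mul, hp, mul_assoc, a2]
  have hσj : σ j = j := by simp only [j, h.sub, h.mul, a3, hσp]; simp
  have cwj : Commute w1 j := by
    change w1 * j = j * w1
    simp only [j, mul_sub, sub_mul, a1, a2, mul_assoc]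
  obtain ⟨g, hg⟩ := exists_invsqrt' h2 hj
  set s := Polynomial.aeval j g with hs_def
  have cws : Commute w1 s := by
    exact (commute_aeval_r g cwj)
  have cps : Commute p s := by
    refine (commute_aeval_r g ?_)
    change p * j = j * p
    rw [hpj, hjp]
  have hσs : σ s = s := by rw [hs_def, h.aeval hs, hσj]
  refine ⟨w1 * s, by rw [← mul_assoc, a1], by rw [mul_assoc, ← cps.eq, ← mul_assoc, a2], ?_, ?_⟩
  · have : w1 * s * (w1 * s) = p * (1 + j) * s ^ 2 := by
      have : p * (1 + j) = w1 * w1 := by rw [mul_add, hpj, mul_one]; simp [j]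
      rw [this, mul_assoc, ← mul_assoc s, ← cws.eq, sq]; simp only [mul_assoc]
    rw [this, mul_assoc]
    have cjs : Commute (1 + j) (s ^ 2) :=
      ((Commute.one_left s).add_left
        (commute_aeval_r g (Commute.refl j))).pow_right 2
    rw [cjs.eq, hg, mul_one]
  · rw [h.mul, hσs, a3, cws.eq]; simp

theorem cancel_gen {K : Type*} {R : Type u} [Field K] (h2 : (2 : K) ≠ 0) [Ring R] [Algebra K R]
    [FiniteDimensional K R] {σ : R → R} (h : IsInvo σ) (hs : ∀ (c : K) x, σ (c • x) = c • σ x)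
    {p u v : R} (hp : p * p = p) (hσp : σ p = p) (hu : u * u = 1) (hσu : σ u = -u)
    (hpv : p * v = 0) (hvp : v * p = 0) (hv : v * v = 1 - p) (hσv : σ v = - v) :
    ∃ w : R, p * w = w ∧ w * p = w ∧ w * w = p ∧ σ w = - w := by
  obtain ⟨S, _, _, _, _, π, σ', h', hs', hπ, hc, hnil⟩ := exists_semisimple_quot h hs
  have half : ∀ x : R, (1/2 : K) • (x + x) = x := by
    intro x; rw [← two_smul K x, smul_smul]; simp [h2]
  let f : R := (1/2 : K) • (1 + u)
  let g : R := (1/2 : K) • (1 - p + v)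
  have hq : (1 - p) * (1 - p) = 1 - p := by rw [mul_sub, sub_mul, sub_mul, hp]; simp
  have hf : f * f = f := by
    simp only [f, smul_mul_assoc, mul_smul_comm]
    congr 1
    rw [mul_add, add_mul, add_mul, hu]
    conv_rhs => rw [← half (1 + u)]
    congr 1; simp only [one_mul, mul_one]; abel
  have hg : g * g = g := by
    simp only [g, smul_mul_assoc, mul_smul_comm]
    congr 1
    have q1 : (1 - p) * v = v := by rw [sub_mul, hpv]; simp
    have q2 : v * (1 - p) = v := by rw [mul_sub, hvp]; simp
    rw [mul_add, add_mul, add_mul, hv, hq, q1, q2]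
    conv_rhs => rw [← half (1 - p + v)]
    congr 1; abel
  have hσf : σ f = 1 - f := by
    rw [eq_sub_iff_add_eq]
    simp only [f, hs, h.add, h.one, hσu, ← smul_add]
    conv_rhs => rw [← half 1]
    congr 1; abel
  have hσg : σ g = 1 - p - g := by
    rw [eq_sub_iff_add_eq]
    simp only [g, hs, h.add, h.one, hσv, h.sub, hσp, ← smul_add]
    conv_rhs => rw [← half (1 - p)]
    congr 1; abel
  have hpg : p * g = 0 := by
    simp only [g, mul_smul_comm, mul_add, mul_sub, hp, hpv]; simp
  have hgp : g * p = 0 := by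
    simp only [g, smul_mul_assoc, add_mul, sub_mul, hp, hvp]; simp
  obtain ⟨w, w1, w2, w3, w4⟩ := cancel_semisimple h' (p := π p) (f := π f) (g := π g)
    (by rw [← map_mul, hp]) (by rw [hc, hσp]) (by rw [← map_mul, hf])
    (by rw [hc, hσf, map_sub, map_one]) (by rw [← map_mul, hg])
    (by rw [hc, hσg, map_sub, map_sub, map_one]) (by rw [← map_mul, hpg, map_zero])
    (by rw [← map_mul, hgp, map_zero])
  exact lift_skew h2 h hs π hπ hc hnil hp hσp w1 w2 w3 w4
end Part2

section Part3
open Matrix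

def conjT {A : Type*} (σ : A → A) {ι κ : Type*} (u : Matrix ι κ A) : Matrix κ ι A := (u.map σ)ᵀ

theorem conjT_apply {A : Type*} (σ : A → A) {ι κ : Type*} (u : Matrix ι κ A) (i j) :
    conjT σ u i j = σ (u j i) := rfl

def mG {K : Type*} (A : Type*) [Field K] [Ring A] [Algebra K A] {ι : Type*} (G : Matrix ι ι K) :
    Matrix ι ι A := G.map (algebraMap K A)

def HypG {K A : Type*} [Field K] [Ring A] [Algebra K A] (σ : A → A) {ι : Type*} [Fintype ι]
    [DecidableEq ι] (G : Matrix ι ι K) : Prop :=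
  ∃ u : Matrix ι ι A, u * u = 1 ∧ conjT σ u * mG A G = -(mG A G * u)

section
variable {A : Type*} [Ring A] {σ : A → A}

theorem IsInvo.conjT_mul (h : IsInvo σ) {ι κ μ : Type*} [Fintype κ] (u : Matrix ι κ A)
    (v : Matrix κ μ A) : conjT σ (u * v) = conjT σ v * conjT σ u := by
  ext i j
  simp [conjT_apply, Matrix.mul_apply, h.sum, h.mul]

theorem IsInvo.conjT_invo (h : IsInvo σ) {ι : Type*} [Fintype ι] [DecidableEq ι] :
    IsInvo (conjT σ : Matrix ι ι A → Matrix ι ι A) where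
  add x y := by ext i j; simp [conjT_apply, h.add]
  mul x y := h.conjT_mul x y
  inv x := by ext i j; simp [conjT_apply, h.inv]

variable {K : Type*} [Field K] [Algebra K A]

theorem IsInvo.algebraMap (h : IsInvo σ) (hs : ∀ (c : K) x, σ (c • x) = c • σ x) (c : K) :
    σ (algebraMap K A c) = algebraMap K A c := by
  rw [Algebra.algebraMap_eq_smul_one, hs, h.one]

theorem conjT_mG (h : IsInvo σ) (hs : ∀ (c : K) x, σ (c • x) = c • σ x) {ι : Type*}
    (G : Matrix ι ι K) : conjT σ (mG A G) = mG A Gᵀ := by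
  ext i j
  simp [conjT_apply, mG, h.algebraMap hs]

theorem mG_mul {ι : Type*} [Fintype ι] (G H : Matrix ι ι K) : mG A (G * H) = mG A G * mG A H := by
  simp [mG, Matrix.map_mul]

theorem mG_one {ι : Type*} [Fintype ι] [DecidableEq ι] : mG A (1 : Matrix ι ι K) = 1 := by
  simp [mG]

theorem mG_neg {ι : Type*} (G : Matrix ι ι K) : mG A (-G) = - mG A G := by
  ext; simp [mG]

variable {ι κ : Type*} [Fintype ι] [DecidableEq ι] [Fintype κ] [DecidableEq κ]

theorem hypG_one_iff : HypG (K := K) σ (1 : Matrix ι ι K) ↔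
    ∃ u : Matrix ι ι A, u * u = 1 ∧ conjT σ u = -u := by
  simp [HypG, mG_one]

theorem HypG.reindex {G : Matrix ι ι K} (hG : HypG σ G) (e : κ ≃ ι) :
    HypG σ (G.submatrix e e) := by
  obtain ⟨u, h1, h2⟩ := hG
  refine ⟨u.submatrix e e, ?_, ?_⟩
  · rw [Matrix.submatrix_mul_equiv, h1]; simp
  · have e1 : conjT σ (u.submatrix e e) = (conjT σ u).submatrix e e := rfl
    have e2 : mG A (G.submatrix e e) = (mG A G).submatrix e e := rfl
    rw [e1, e2, Matrix.submatrix_mul_equiv, Matrix.submatrix_mul_equiv, h2]; rfl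

theorem HypG.one_of_equiv (hG : HypG (K := K) σ (1 : Matrix ι ι K)) (e : κ ≃ ι) :
    HypG (K := K) σ (1 : Matrix κ κ K) := by
  have := hG.reindex e
  simpa using this

theorem HypG.blockDiag {G : Matrix ι ι K} (h : IsInvo σ) (hG : HypG σ G) :
    HypG σ (blockDiagonal fun _ : κ => G) := by
  obtain ⟨u, h1, h2⟩ := hG
  have e1 : conjT σ (blockDiagonal fun _ : κ => u) = blockDiagonal fun _ : κ => conjT σ u := by
    ext ⟨i, a⟩ ⟨j, b⟩
    simp only [conjT_apply, blockDiagonal_apply]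
    by_cases hab : a = b
    · simp [hab]
    · simp [hab, Ne.symm hab, h.zero]
  have e2 : mG A (blockDiagonal fun _ : κ => G) = blockDiagonal fun _ : κ => mG A G := by
    ext ⟨i, a⟩ ⟨j, b⟩
    simp only [mG, Matrix.map_apply, blockDiagonal_apply]
    split_ifs <;> simp
  refine ⟨blockDiagonal fun _ => u, ?_, ?_⟩
  · rw [← blockDiagonal_mul]; simp only [h1]; exact blockDiagonal_one
  · rw [e1, e2, ← blockDiagonal_mul, ← blockDiagonal_mul, ← blockDiagonal_neg]
    congr 1; ext1 k; exact h2

theorem conjT_fromBlocks (h : IsInvo σ) (a : Matrix ι ι A) (d : Matrix κ κ A) :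
    conjT σ (fromBlocks a 0 0 d) = fromBlocks (conjT σ a) 0 0 (conjT σ d) := by
  ext (i | i) (j | j) <;> simp [conjT_apply, h.zero]

theorem mG_fromBlocks (a : Matrix ι ι K) (d : Matrix κ κ K) :
    mG A (fromBlocks a 0 0 d) = fromBlocks (mG A a) 0 0 (mG A d) := by
  ext (i | i) (j | j) <;> simp [mG]

theorem HypG.sum {G : Matrix ι ι K} {H : Matrix κ κ K} (h : IsInvo σ) (hG : HypG σ G)
    (hH : HypG σ H) : HypG σ (fromBlocks G 0 0 H) := by
  obtain ⟨u, h1, h2⟩ := hG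
  obtain ⟨v, h3, h4⟩ := hH
  refine ⟨fromBlocks u 0 0 v, ?_, ?_⟩
  · simp [fromBlocks_multiply, h1, h3]
  · rw [conjT_fromBlocks h, mG_fromBlocks]
    simp [fromBlocks_multiply, h2, h4, fromBlocks_neg]

theorem HypG.cancel [FiniteDimensional K A] (k2 : (2 : K) ≠ 0) (h : IsInvo σ)
    (hs : ∀ (c : K) x, σ (c • x) = c • σ x) {G : Matrix ι ι K} {H : Matrix κ κ K}
    (hGT : Gᵀ = G) (hHT : Hᵀ = H) (hGu : IsUnit G.det) (hHu : IsUnit H.det)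
    (hGH : HypG σ (fromBlocks G 0 0 H)) (hH : HypG σ H) : HypG σ G := by
  obtain ⟨u, h1, h2⟩ := hGH
  obtain ⟨v, h3, h4⟩ := hH
  set N : Matrix (ι ⊕ κ) (ι ⊕ κ) K := fromBlocks G 0 0 H with hN
  have hNT : Nᵀ = N := by rw [hN, fromBlocks_transpose, hGT, hHT]; simp
  have hNu : IsUnit N.det := by
    rw [hN, det_fromBlocks_zero₂₁]; exact hGu.mul hHu
  have hNT' : (N⁻¹)ᵀ = N⁻¹ := by rw [transpose_nonsing_inv, hNT]
  let B := mG A N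
  let C := mG A N⁻¹
  have hBC : B * C = 1 := by
    rw [← mG_mul, Matrix.mul_nonsing_inv _ hNu, mG_one]
  have hCB : C * B = 1 := by
    rw [← mG_mul, Matrix.nonsing_inv_mul _ hNu, mG_one]
  have hσB : conjT σ B = B := by rw [conjT_mG h hs, hNT]
  have hσC : conjT σ C = C := by rw [conjT_mG h hs, hNT']
  let τ : Matrix (ι ⊕ κ) (ι ⊕ κ) A → Matrix (ι ⊕ κ) (ι ⊕ κ) A := fun x => C * conjT σ x * B
  have hτ : IsInvo τ := by
    refine ⟨fun x y => ?_, fun x y => ?_, fun x => ?_⟩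
    · simp only [τ]; rw [(h.conjT_invo (ι := ι ⊕ κ)).add]; noncomm_ring
    · simp only [τ]; rw [h.conjT_mul]
      calc C * (conjT σ y * conjT σ x) * B = C * conjT σ y * 1 * conjT σ x * B := by noncomm_ring
        _ = _ := by rw [← hBC]; noncomm_ring
    · simp only [τ]; rw [h.conjT_mul, h.conjT_mul, hσB, hσC, (h.conjT_invo (ι := ι ⊕ κ)).inv]
      calc C * (B * (x * C)) * B = (C * B) * x * (C * B) := by noncomm_ring
        _ = _ := by rw [hCB]; simp
  have hτs : ∀ (c : K) x, τ (c • x) = c • τ x := by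
    intro c x
    have : conjT σ (c • x) = c • conjT σ x := by ext i j; simp [conjT_apply, hs]
    simp only [τ]; rw [this]; simp
  have skew : ∀ x, conjT σ x * B = -(B * x) → τ x = - x := by
    intro x hx
    simp only [τ]; rw [mul_assoc, hx, mul_neg, ← mul_assoc, hCB, one_mul]
  have unskew : ∀ x, τ x = - x → conjT σ x * B = -(B * x) := by
    intro x hx
    have : B * τ x = conjT σ x * B := by
      simp only [τ]; rw [← mul_assoc, ← mul_assoc, hBC, one_mul]
    rw [← this, hx, mul_neg]
  let p : Matrix (ι ⊕ κ) (ι ⊕ κ) A := fromBlocks 1 0 0 0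
  have hB : B = fromBlocks (mG A G) 0 0 (mG A H) := mG_fromBlocks G H
  have hpp : p * p = p := by simp [p, fromBlocks_multiply]
  have hτp : τ p = p := by
    have : conjT σ p * B = B * p := by
      simp only [p]; rw [conjT_fromBlocks h, hB]
      have := (h.conjT_invo (ι := ι)).one
      have h0 := (h.conjT_invo (ι := κ)).zero
      simp [fromBlocks_multiply, this, h0]
    simp only [τ]; rw [mul_assoc, this, ← mul_assoc, hCB, one_mul]
  obtain ⟨w, w1, w2, w3, w4⟩ := cancel_gen k2 hτ hτs (p := p) (u := u) (v := fromBlocks 0 0 0 v)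
    hpp hτp h1 (skew u h2) (by simp [p, fromBlocks_multiply]) (by simp [p, fromBlocks_multiply])
    (by
      rw [← fromBlocks_one]
      simp only [p, fromBlocks_multiply, h3, sub_eq_add_neg, fromBlocks_neg, fromBlocks_add]
      simp) (by
      apply skew
      rw [conjT_fromBlocks h, hB]
      have := (h.conjT_invo (ι := ι)).zero
      rw [this, fromBlocks_multiply, fromBlocks_multiply, fromBlocks_neg]
      simp [h4])
  have hw : w = fromBlocks w.toBlocks₁₁ 0 0 0 := by
    have : w = p * w * p := by rw [w1, w2]
    rw [← fromBlocks_toBlocks w] at this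
    simp only [p, fromBlocks_multiply] at this
    rw [← fromBlocks_toBlocks w, this]; simp
  have w5 := unskew w w4
  rw [hw, conjT_fromBlocks h, hB] at w5
  rw [hw] at w3
  simp only [fromBlocks_multiply, p, fromBlocks_neg, fromBlocks_inj] at w3 w5
  refine ⟨w.toBlocks₁₁, ?_, ?_⟩
  · simpa using w3.1
  · simpa using w5.1

theorem HypG.of_field (h : IsInvo σ) (hs : ∀ (c : K) x, σ (c • x) = c • σ x) {G u : Matrix ι ι K}
    (hu : u * u = 1) (hG : uᵀ * G = -(G * u)) : HypG σ G := by
  refine ⟨mG A u, ?_, ?_⟩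
  · rw [← mG_mul, hu, mG_one]
  · rw [conjT_mG h hs, ← mG_mul, hG, mG_neg, mG_mul]

theorem HypG.transfer {A' : Type*} [Ring A'] {σ' : A' → A'}
    (ψ : A' →+* Matrix κ κ A) (G : Matrix κ κ K)
    (hψ : ∀ x, conjT σ (ψ x) * mG A G = mG A G * ψ (σ' x))
    {u : Matrix ι ι A'} (hu : u * u = 1) (hu' : conjT σ' u = - u) :
    HypG σ (blockDiagonal fun _ : ι => G) := by
  refine ⟨Matrix.of fun x y => ψ (u x.2 y.2) x.1 y.1, ?_, ?_⟩
  · ext ⟨a, i⟩ ⟨b, j⟩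
    have h1 : (∑ k, ψ (u i k) * ψ (u k j)) a b = ψ ((1 : Matrix ι ι A') i j) a b := by
      rw [← hu, Matrix.mul_apply, map_sum]; simp only [map_mul]
    simp only [Matrix.mul_apply, Matrix.of_apply, Fintype.sum_prod_type_right]
    rw [Matrix.sum_apply] at h1
    simp only [Matrix.mul_apply] at h1
    rw [h1, Matrix.one_apply]
    by_cases hij : i = j
    · subst hij; simp [Matrix.one_apply]
    · simp [hij, Matrix.one_apply]
  · ext ⟨a, i⟩ ⟨b, j⟩
    have h1 := congrFun (congrFun (hψ (u j i)) a) b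
    have h2 : σ' (u j i) = - u i j := congrFun (congrFun hu' i) j
    rw [h2, map_neg, mul_neg, Matrix.neg_apply, Matrix.mul_apply, Matrix.mul_apply] at h1
    simp only [Matrix.mul_apply, Matrix.neg_apply, Matrix.of_apply, Fintype.sum_prod_type_right,
      conjT_apply, mG, Matrix.map_apply, blockDiagonal_apply]
    have e1 : ∀ (x : κ) (k : ι), σ (ψ (u k i) x a) * (algebraMap K A) (if k = j then G x b else 0)
      = if k = j then σ (ψ (u k i) x a) * algebraMap K A (G x b) else 0 := by
      intro x k; split_ifs <;> simp
    have e2 : ∀ (x : κ) (k : ι), (algebraMap K A) (if i = k then G a x else 0) * ψ (u k j) x b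
      = if i = k then algebraMap K A (G a x) * ψ (u k j) x b else 0 := by
      intro x k; split_ifs <;> simp
    simp only [e1, e2]
    rw [Finset.sum_comm]
    conv_rhs => rw [Finset.sum_comm]
    simp only [Finset.sum_ite_eq', Finset.sum_ite_eq, Finset.mem_univ, if_true]
    exact h1

theorem hyp_iff (k2 : (2 : K) ≠ 0) (n : ℕ) (h : IsInvo σ)
    (hs : ∀ (c : K) x, σ (c • x) = c • σ x) : MatrixInvolutionHyperbolic σ n ↔
    HypG (K := K) σ (1 : Matrix (Fin n) (Fin n) K) := by
  rw [hypG_one_iff]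
  have half : ∀ x : Matrix (Fin n) (Fin n) A, (1/2 : K) • (x + x) = x := by
    intro x; rw [← two_smul K x, smul_smul]; simp [k2]
  constructor
  · rintro ⟨e, he, hσe⟩
    have hσe : conjT σ e = 1 - e := by rw [eq_sub_iff_add_eq, ← hσe]; rfl
    have hI := h.conjT_invo (ι := Fin n)
    refine ⟨e + e - 1, ?_, ?_⟩
    · simp only [mul_sub, sub_mul, mul_add, add_mul, he, mul_one, one_mul]; abel
    · rw [hI.sub, hI.add, hI.one, hσe]; abel
  · rintro ⟨u, hu, hσu⟩
    refine ⟨(1/2 : K) • (1 + u), ?_, ?_⟩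
    · simp only [smul_mul_assoc, mul_smul_comm]
      congr 1
      rw [mul_add, add_mul, add_mul, hu]
      conv_rhs => rw [← half (1 + u)]
      congr 1; simp only [one_mul, mul_one]; abel
    · change conjT σ ((1/2 : K) • (1 + u)) + _ = 1
      have hI := h.conjT_invo (ι := Fin n)
      have : ∀ (c : K) (x : Matrix (Fin n) (Fin n) A), conjT σ (c • x) = c • conjT σ x := by
        intro c x; ext i j; simp [conjT_apply, hs]
      rw [this, hI.add, hI.one, hσu, ← smul_add]
      conv_rhs => rw [← half 1]
      congr 1; abel

theorem pow_two_min [FiniteDimensional K A] (k2 : (2 : K) ≠ 0) (h : IsInvo σ)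
    (hs : ∀ (c : K) x, σ (c • x) = c • σ x) {k : ℕ}
    (hk : MatrixInvolutionHyperbolic σ (2 ^ k)) :
    ∃ k : ℕ, IsLeast {n : ℕ | 0 < n ∧ MatrixInvolutionHyperbolic σ n} (2 ^ k) := by
  classical
  have hsub : ∀ m n, MatrixInvolutionHyperbolic σ (m + n) → MatrixInvolutionHyperbolic σ n →
      MatrixInvolutionHyperbolic σ m := by
    intro m n
    rw [hyp_iff k2 _ h hs, hyp_iff k2 _ h hs, hyp_iff k2 _ h hs]
    intro h1 h2
    have h1 := h1.one_of_equiv finSumFinEquiv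
    rw [← fromBlocks_one] at h1
    exact HypG.cancel k2 h hs (by simp) (by simp) (by simp) (by simp) h1 h2
  have hex : ∃ n, 0 < n ∧ MatrixInvolutionHyperbolic σ n := ⟨2 ^ k, by positivity, hk⟩
  obtain ⟨n0pos, n0h⟩ := Nat.find_spec hex
  set n0 := Nat.find hex with hn0
  have hq : ∀ q r, MatrixInvolutionHyperbolic σ (r + n0 * q) → MatrixInvolutionHyperbolic σ r := by
    intro q
    induction q with
    | zero => intro r hr; simpa using hr
    | succ q ih => intro r hr; exact ih r (hsub _ n0 (by rwa [mul_add, mul_one, ← add_assoc] at hr) n0h)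
  have hr : MatrixInvolutionHyperbolic σ (2 ^ k % n0) := hq (2 ^ k / n0) _ (by
    rwa [Nat.mod_add_div])
  have hdvd : n0 ∣ 2 ^ k := by
    rw [Nat.dvd_iff_mod_eq_zero]
    by_contra hne
    exact Nat.find_min hex (Nat.mod_lt _ n0pos) ⟨Nat.pos_of_ne_zero hne, hr⟩
  obtain ⟨j, _, hj⟩ := (Nat.dvd_prime_pow Nat.prime_two).1 hdvd
  refine ⟨j, ?_⟩
  rw [← hj]
  exact ⟨⟨n0pos, n0h⟩, fun n hn => Nat.find_min' hex hn⟩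
end
end Part3

section Part4
section
variable {K : Type*} [Field K] (O : FieldOrdering K)

theorem FieldOrdering.zero_notMem : (0 : K) ∉ O.carrier := by
  intro h
  exact O.disjoint' 0 h (by simpa using h)

theorem FieldOrdering.sq_mem {c : K} (hc : c ≠ 0) : c * c ∈ O.carrier := by
  rcases O.total' c hc with h | h
  · exact O.mul_mem' h h
  · simpa using O.mul_mem' h h

def FieldOrdering.nn (x : K) : Prop := x = 0 ∨ x ∈ O.carrier

theorem FieldOrdering.nn_add {x y : K} (hx : O.nn x) (hy : O.nn y) : O.nn (x + y) := by
  rcases hx with rfl | hx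
  · simpa using hy
  · rcases hy with rfl | hy
    · right; simpa using hx
    · right; exact O.add_mem' hx hy

theorem FieldOrdering.add_mem_nn {x y : K} (hx : x ∈ O.carrier) (hy : O.nn y) :
    x + y ∈ O.carrier := by
  rcases hy with rfl | hy
  · simpa using hx
  · exact O.add_mem' hx hy

theorem FieldOrdering.nn_mul {x y : K} (hx : O.nn x) (hy : O.nn y) : O.nn (x * y) := by
  rcases hx with rfl | hx
  · left; simp
  · rcases hy with rfl | hy
    · left; simp
    · right; exact O.mul_mem' hx hy

theorem FieldOrdering.nn_sq (x : K) : O.nn (x * x) := by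
  by_cases h : x = 0
  · left; simp [h]
  · right; exact O.sq_mem h

theorem FieldOrdering.nn_sum {ι : Type*} (s : Finset ι) (f : ι → K) (h : ∀ i ∈ s, O.nn (f i)) :
    O.nn (∑ i ∈ s, f i) := by
  classical
  induction s using Finset.induction_on with
  | empty => left; simp
  | insert a s ha ih =>
    rw [Finset.sum_insert ha]
    exact O.nn_add (h a (by simp)) (ih fun i hi => h i (by simp [hi]))

theorem FieldOrdering.nn_not {x : K} (h : O.nn (-x)) : x ∉ O.carrier := by
  rcases h with h | h
  · rw [neg_eq_zero.1 h]; exact O.zero_notMem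
  · intro hx; exact O.disjoint' x hx h

theorem FieldOrdering.nn_of_not {x : K} (h : x ∉ O.carrier) : O.nn (-x) := by
  by_cases hx : x = 0
  · left; simp [hx]
  · right; exact (O.total' x hx).resolve_left h

variable {V : Type*} [AddCommGroup V] [Module K V]

def posDims (Q : V → K) : Set ℕ := {n : ℕ | ∃ U : Submodule K V, Module.finrank K U = n ∧
      ∀ v ∈ U, v ≠ 0 → Q v ∈ O.carrier}

theorem signatureAt_eq (Q : V → K) : signatureAt O Q =
    ((sSup (posDims O Q) : ℕ) : ℤ) - (sSup (posDims O (fun v => - Q v)) : ℕ) := rfl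

theorem posDims_greatest {ι : Type*} [Fintype ι] (b : Basis ι K V) (w : ι → K) (Q : V → K)
    (hQ : ∀ v, Q v = ∑ i, w i * (b.repr v i * b.repr v i)) :
    IsGreatest (posDims O Q) (Nat.card {i // w i ∈ O.carrier}) := by
  classical
  have : FiniteDimensional K V := b.finiteDimensional_of_finite
  rw [Nat.card_eq_fintype_card]
  constructor
  · refine ⟨Submodule.span K (Set.range fun i : {i // w i ∈ O.carrier} => b i), ?_, ?_⟩
    · apply finrank_span_eq_card
      exact b.linearIndependent.comp _ Subtype.val_injective
    · intro v hv hv0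
      have : (Set.range fun i : {i // w i ∈ O.carrier} => b i) = b '' {i | w i ∈ O.carrier} := by
        ext x; simp
      rw [this, Basis.mem_span_image] at hv
      have hz : ∀ i, b.repr v i ≠ 0 → w i ∈ O.carrier := fun i hi => hv (by simpa using hi)
      have : ∃ i, b.repr v i ≠ 0 := by
        by_contra hcon
        push Not at hcon
        apply hv0
        apply b.repr.injective
        ext i; simp [hcon]
      obtain ⟨i, hi⟩ := this
      rw [hQ, ← Finset.add_sum_erase _ _ (Finset.mem_univ i)]
      apply O.add_mem_nn
      · exact O.mul_mem' (hz i hi) (O.sq_mem hi)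
      · apply O.nn_sum
        intro j _
        by_cases hj : b.repr v j = 0
        · left; simp [hj]
        · exact O.nn_mul (Or.inr (hz j hj)) (O.nn_sq _)
  · rintro n ⟨U, rfl, hU⟩
    let φ : U →ₗ[K] ({i // w i ∈ O.carrier} → K) :=
      LinearMap.pi fun i => (Finsupp.lapply (i : ι)).comp (b.repr.toLinearMap.comp U.subtype)
    have hφ : Function.Injective φ := by
      rw [← LinearMap.ker_eq_bot, LinearMap.ker_eq_bot']
      rintro ⟨v, hv⟩ h0
      by_contra hne
      have hv0 : v ≠ 0 := by simpa using hne
      have h1 : ∀ i, w i ∈ O.carrier → b.repr v i = 0 := fun i hi => congrFun h0 ⟨i, hi⟩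
      refine O.nn_not ?_ (hU v hv hv0)
      rw [hQ, ← Finset.sum_neg_distrib]
      apply O.nn_sum
      intro i _
      by_cases hi : w i ∈ O.carrier
      · left; simp [h1 i hi]
      · rw [← neg_mul]; exact O.nn_mul (O.nn_of_not hi) (O.nn_sq _)
    have := LinearMap.finrank_le_finrank_of_injective hφ
    simpa using this

theorem signatureAt_diag {ι : Type*} [Fintype ι] (b : Basis ι K V) (w : ι → K) (Q : V → K)
    (hQ : ∀ v, Q v = ∑ i, w i * (b.repr v i * b.repr v i)) :
    signatureAt O Q = (Nat.card {i // w i ∈ O.carrier} : ℤ) - Nat.card {i // - w i ∈ O.carrier} := by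
  rw [signatureAt_eq, (posDims_greatest O b w Q hQ).csSup_eq,
    (posDims_greatest O b (fun i => - w i) (fun v => - Q v) (fun v => by
      rw [hQ, ← Finset.sum_neg_distrib]; simp)).csSup_eq]

end

noncomputable def traceBil (K : Type*) {A : Type*} [Field K] [Ring A] [Algebra K A]
    (σ : A →ₗ[K] A) : LinearMap.BilinMap K A K :=
  (LinearMap.mul K A).compl₁₂ σ LinearMap.id |>.compr₂
    ((LinearMap.trace K A).comp (LinearMap.mul K A))

theorem exists_diag {K : Type*} {A : Type*} [Field K] (k2 : (2 : K) ≠ 0) [Ring A] [Algebra K A]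
    [FiniteDimensional K A] {σ : A → A} (h : IsInvo σ) (hs : ∀ (c : K) x, σ (c • x) = c • σ x) :
    ∃ (b : Basis (Fin (finrank K A)) K A) (w : Fin (finrank K A) → K),
      ∀ v, involutionTraceForm K σ v = ∑ i, w i * (b.repr v i * b.repr v i) := by
  let σl : A →ₗ[K] A := { toFun := σ, map_add' := h.add, map_smul' := hs }
  let Q : QuadraticForm K A := LinearMap.BilinMap.toQuadraticMap (traceBil K σl)
  have : Invertible (2 : K) := invertibleOfNonzero k2
  obtain ⟨w, ⟨e⟩⟩ := QuadraticForm.equivalent_weightedSumSquares Q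
  refine ⟨Basis.ofEquivFun e.toLinearEquiv, w, fun v => ?_⟩
  have h1 := e.map_app v
  rw [QuadraticMap.weightedSumSquares_apply] at h1
  have h2 : Q v = involutionTraceForm K σ v := rfl
  rw [← h2, ← h1]
  rfl

theorem a_imp_b {K : Type*} {A : Type*} [Field K] (k2 : (2 : K) ≠ 0) [Ring A] [Algebra K A]
    [FiniteDimensional K A] {σ : A → A} (h : IsInvo σ) (hs : ∀ (c : K) x, σ (c • x) = c • σ x)
    (O : FieldOrdering K) {n : ℕ} (hn : 0 < n) (hyp : MatrixInvolutionHyperbolic σ n) :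
    signatureAt O (involutionTraceForm K σ) = 0 := by
  classical
  rw [hyp_iff k2 n h hs, hypG_one_iff] at hyp
  obtain ⟨u, hu, hσu⟩ := hyp
  obtain ⟨b, w, hb⟩ := exists_diag k2 h hs
  let Qn : (Fin n → A) → K := fun x => ∑ i, involutionTraceForm K σ (x i)
  let bb := Pi.basis (fun _ : Fin n => b)
  have hQn : ∀ v, Qn v = ∑ i, w i.2 * (bb.repr v i * bb.repr v i) := by
    intro v
    simp only [Qn, hb, Fintype.sum_sigma]
    rfl
  let τ : A →ₗ[K] K := (LinearMap.trace K A).comp (LinearMap.mul K A)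
  have hτ : ∀ x, involutionTraceForm K σ x = τ (σ x * x) := fun x => rfl
  have hQu : ∀ x, Qn (u.mulVec x) = - Qn x := by
    intro x
    have e1 : ∀ x, Qn x = τ ((conjT σ (Matrix.replicateCol Unit x) *
      Matrix.replicateCol Unit x) () ()) := by
      intro x
      simp [Qn, hτ, Matrix.mul_apply, conjT_apply]
    rw [e1, e1, Matrix.replicateCol_mulVec, h.conjT_mul, hσu, Matrix.mul_assoc,
      ← Matrix.mul_assoc (-u), Matrix.neg_mul, hu, Matrix.neg_mul, Matrix.one_mul, Matrix.mul_neg,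
      Matrix.neg_apply, map_neg]
  have huu : ∀ x, u.mulVec (u.mulVec x) = x := by
    intro x; rw [Matrix.mulVec_mulVec, hu, Matrix.one_mulVec]
  let ul : (Fin n → A) ≃ₗ[K] (Fin n → A) :=
    LinearEquiv.ofInvolutive
     { toFun := u.mulVec
       map_add' := fun x y => Matrix.mulVec_add _ _ _
       map_smul' := fun c x => Matrix.mulVec_smul _ _ _ } huu
  have hul : ∀ x, Qn (ul x) = - Qn x := hQu
  have hsets : posDims O Qn = posDims O (fun v => - Qn v) := by
    ext m
    constructor
    · rintro ⟨U, hU, hU2⟩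
      refine ⟨U.map ul.toLinearMap, ?_, ?_⟩
      · rw [← hU]; exact LinearEquiv.finrank_map_eq ul U
      · rintro _ ⟨v, hv, rfl⟩ hv0
        simp only [LinearEquiv.coe_coe] at hv0 ⊢
        rw [hul, neg_neg]; exact hU2 v hv (by rintro rfl; simp at hv0)
    · rintro ⟨U, hU, hU2⟩
      refine ⟨U.map ul.toLinearMap, ?_, ?_⟩
      · rw [← hU]; exact LinearEquiv.finrank_map_eq ul U
      · rintro _ ⟨v, hv, rfl⟩ hv0
        simp only [LinearEquiv.coe_coe] at hv0 ⊢
        rw [hul]; exact hU2 v hv (by rintro rfl; simp at hv0)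
  have h0 : signatureAt O Qn = 0 := by
    rw [signatureAt_eq, hsets, sub_self]
  rw [signatureAt_diag O bb _ Qn hQn] at h0
  rw [signatureAt_diag O b w _ hb]
  have hc : ∀ p : Fin (finrank K A) → Prop,
      Nat.card {i : Σ _ : Fin n, Fin (finrank K A) // p i.2} = n * Nat.card {i // p i} := by
    intro p
    let e : {i : Σ _ : Fin n, Fin (finrank K A) // p i.2} ≃ Fin n × {i // p i} :=
      { toFun := fun i => (i.1.1, ⟨i.1.2, i.2⟩)
        invFun := fun i => ⟨⟨i.1, i.2.1⟩, i.2.2⟩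
        left_inv := fun i => rfl
        right_inv := fun i => rfl }
    rw [Nat.card_congr e, Nat.card_prod]; simp
  rw [hc (fun i => w i ∈ O.carrier), hc (fun i => - w i ∈ O.carrier)] at h0
  push_cast at h0
  rw [← mul_sub] at h0
  rcases mul_eq_zero.1 h0 with h0 | h0
  · omega
  · exact h0
end Part4

section Part5
open Polynomial

structure RCF (L : Type*) [Field L] : Prop where
  sq : ∀ a : L, IsSquare a ∨ IsSquare (-a)
  add : ∀ a b : L, IsSquare a → IsSquare b → IsSquare (a + b)
  neg : ¬ IsSquare (-1 : L)
  irr : ∀ p : L[X], p.Monic → Irreducible p → (∃ α, p = X - C α) ∨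
    ∃ α β, β ≠ 0 ∧ p = (X - C α) ^ 2 + C (β ^ 2)

def RCF.ordering {L : Type*} [Field L] (hL : RCF L) : FieldOrdering L where
  carrier := {a | a ≠ 0 ∧ IsSquare a}
  add_mem' := by
    rintro a b ⟨ha, ha'⟩ ⟨hb, hb'⟩
    refine ⟨fun h => ?_, hL.add a b ha' hb'⟩
    obtain ⟨x, rfl⟩ := ha'
    obtain ⟨y, rfl⟩ := hb'
    have hy : y ≠ 0 := by rintro rfl; simp at hb
    apply hL.neg
    refine ⟨x / y, ?_⟩
    field_simp
    linear_combination -h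
  mul_mem' := by
    rintro a b ⟨ha, ha'⟩ ⟨hb, hb'⟩
    exact ⟨mul_ne_zero ha hb, ha'.mul hb'⟩
  total' := by
    intro a ha
    rcases hL.sq a with h | h
    · exact Or.inl ⟨ha, h⟩
    · exact Or.inr ⟨neg_ne_zero.2 ha, h⟩
  disjoint' := by
    rintro a ⟨ha, x, rfl⟩ ⟨_, y, hy⟩
    have hx : x ≠ 0 := by rintro rfl; simp at ha
    apply hL.neg
    refine ⟨y / x, ?_⟩
    field_simp
    linear_combination hy

structure InC {S : Type*} [Ring S] (f c : S) : Prop where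
  l : f * c = c
  r : c * f = c

/-- no bad pair in the corner -/
def NB {S : Type*} [Ring S] (σ : S → S) (f : S) : Prop :=
  ∀ ε z : S, InC f ε → σ ε = ε → ε * ε = ε → ε ≠ 0 → ε * z = z → z * ε = z →
    σ z * z = -ε → z * σ z = -ε → False

section
variable {L : Type*} [Field L] {S : Type*} [Ring S] [Algebra L S]
  {σ : S → S} {f : S}

theorem InC.mul {a b : S} (ha : InC f a) (hb : InC f b) : InC f (a * b) :=
  ⟨by rw [← mul_assoc, ha.l], by rw [mul_assoc, hb.r]⟩

theorem InC.add {a b : S} (ha : InC f a) (hb : InC f b) : InC f (a + b) :=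
  ⟨by rw [mul_add, ha.l, hb.l], by rw [add_mul, ha.r, hb.r]⟩

theorem InC.sub {a b : S} (ha : InC f a) (hb : InC f b) : InC f (a - b) :=
  ⟨by rw [mul_sub, ha.l, hb.l], by rw [sub_mul, ha.r, hb.r]⟩

theorem InC.smul {a : S} (c : L) (ha : InC f a) : InC f (c • a) :=
  ⟨by rw [mul_smul_comm, ha.l], by rw [smul_mul_assoc, ha.r]⟩

theorem InC.invo (h : IsInvo σ) (hf : σ f = f) {a : S} (ha : InC f a) : InC f (σ a) :=
  ⟨by conv_lhs => rw [← hf]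
      rw [← h.mul, ha.r], by
      conv_lhs => rw [← hf]
      rw [← h.mul, ha.l]⟩

theorem InC.of_comm {s r : S} (hs : InC f s) (hc : Commute s r) : InC f (s * r) :=
  ⟨by rw [← mul_assoc, hs.l], by rw [hc.eq, mul_assoc, hs.r]⟩

theorem aniso [IsSemisimpleRing S] (h : IsInvo σ) (hf : σ f = f) (hff : f * f = f) (hnb : NB σ f) {c : S}
    (hc : InC f c) (h0 : σ c * c = 0) : c = 0 := by
  by_contra hne
  obtain ⟨g, hg, hgs⟩ := IsSemisimpleRing.ideal_eq_span_idempotent (Ideal.span {σ c})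
  have h1 : σ c ∈ Ideal.span {g} := by rw [← hgs]; exact Ideal.subset_span rfl
  have h2 : g ∈ Ideal.span {σ c} := by rw [hgs]; exact Ideal.subset_span rfl
  obtain ⟨s, hs⟩ := Ideal.mem_span_singleton'.1 h2
  obtain ⟨r, hr⟩ := Ideal.mem_span_singleton'.1 h1
  have hcg : σ c * g = σ c := by rw [← hr, mul_assoc, hg]
  have hc' := hc.invo h hf
  have hgf : g * f = g := by rw [← hs, mul_assoc, hc'.r]
  have hgg : g * σ g = 0 := by
    rw [← hs, h.mul, h.inv, mul_assoc, ← mul_assoc (σ c), h0]; simp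
  set a := f * g with ha
  have haa : a * a = a := by
    rw [ha, mul_assoc, ← mul_assoc g, hgf, hg]
  have hfa : InC f a := ⟨by rw [ha, ← mul_assoc, hff], by rw [ha, mul_assoc, hgf]⟩
  have hca : σ c * a = σ c := by rw [ha, ← mul_assoc, hc'.r, hcg]
  have ha0 : a * σ a = 0 := by
    rw [ha, h.mul, mul_assoc, ← mul_assoc g, hgg]; simp
  have hσa : σ a * σ a = σ a := by rw [← h.mul, haa]
  have hfσ := hfa.invo h hf
  clear_value a
  have hww : (a - σ a) * (a - σ a) = a + σ a - σ a * a := by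
    rw [mul_sub, sub_mul, sub_mul, haa, ha0, hσa]; abel
  have hpw : (a + σ a - σ a * a) * (a - σ a) = a - σ a := by
    have e1 : σ a * a * a = σ a * a := by rw [mul_assoc, haa]
    have e2 : σ a * a * σ a = 0 := by rw [mul_assoc, ha0, mul_zero]
    simp only [mul_sub, sub_mul, add_mul, haa, ha0, hσa, e1, e2]; abel
  have hwp : (a - σ a) * (a + σ a - σ a * a) = a - σ a := by
    have e1 : a * (σ a * a) = 0 := by rw [← mul_assoc, ha0, zero_mul]
    have e2 : σ a * (σ a * a) = σ a * a := by rw [← mul_assoc, hσa]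
    simp only [mul_sub, sub_mul, mul_add, haa, ha0, hσa, e1, e2]; abel
  have hσw : σ (a - σ a) = -(a - σ a) := by rw [h.sub, h.inv]; abel
  refine hnb (a + σ a - σ a * a) (a - σ a) ((hfa.add hfσ).sub (hfσ.mul hfa)) ?_ ?_ ?_ hpw hwp ?_ ?_
  · rw [h.sub, h.add, h.inv, h.mul, h.inv]; abel
  · calc (a + σ a - σ a * a) * (a + σ a - σ a * a)
          = (a - σ a) * ((a - σ a) * (a + σ a - σ a * a)) := by rw [← mul_assoc, hww]
        _ = _ := by rw [hwp, hww]
  · intro hp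
    rw [hp, mul_zero] at hwp
    have : a = σ a := sub_eq_zero.1 hwp.symm
    rw [← this, haa] at ha0
    rw [ha0, mul_zero] at hca
    exact hne (by rw [← h.inv c, ← hca, h.zero])
  · rw [hσw, neg_mul, hww]
  · rw [hσw, mul_neg, hww]

theorem eig [FiniteDimensional L S] [IsSemisimpleRing S] (hL : RCF L) (h : IsInvo σ)
    (hs : ∀ (c : L) x, σ (c • x) = c • σ x) (hf : σ f = f) (hff : f * f = f)
    (hnb : NB σ f) {s : S} (hsC : InC f s) (hss : σ s = s) (hs0 : s ≠ 0) :
    ∃ (c : L) (ε : S), c ≠ 0 ∧ InC f ε ∧ σ ε = ε ∧ ε * ε = ε ∧ ε ≠ 0 ∧ s * ε = c • ε ∧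
      ε * s = c • ε := by
  classical
  have hI := h.aeval hs
  have key : ∀ t : S, InC f t → σ t = t → t * t = 0 → t = 0 := fun t ht1 ht2 ht3 =>
    aniso h hf hff hnb ht1 (by rw [ht2, ht3])
  have hcomm : ∀ p q : L[X], aeval s p * aeval s q = aeval s q * aeval s p := by
    intro p q; rw [← map_mul, mul_comm, map_mul]
  have hcs : ∀ p : L[X], Commute s (aeval s p) := fun p => commute_aeval_r p (Commute.refl s)
  have hex : ∃ n, ∃ g : L[X], g ≠ 0 ∧ s * aeval s g = 0 ∧ g.natDegree = n :=
    ⟨_, minpoly L s, minpoly.ne_zero (Algebra.IsIntegral.isIntegral s), by simp, rfl⟩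
  obtain ⟨g, hg0, hg, hgn⟩ := Nat.find_spec hex
  have hmin : ∀ k : L[X], k ≠ 0 → s * aeval s k = 0 → g.natDegree ≤ k.natDegree := by
    intro k hk hk2
    rw [hgn]; exact Nat.find_min' hex ⟨k, hk, hk2, rfl⟩
  have hgu : ¬ IsUnit g := by
    intro hu
    obtain ⟨c, hc, rfl⟩ := Polynomial.isUnit_iff.1 hu
    rw [aeval_C, Algebra.algebraMap_eq_smul_one, mul_smul_comm, mul_one] at hg
    exact hs0 ((smul_eq_zero.1 hg).resolve_left hc.ne_zero)
  obtain ⟨π, hπm, hπ, k, hk⟩ := Polynomial.exists_monic_irreducible_factor g hgu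
  have hk0 : k ≠ 0 := by rintro rfl; simp at hk; exact hg0 hk
  have hkd : k.natDegree < g.natDegree := by
    rw [hk, natDegree_mul hπ.ne_zero hk0]
    have := hπ.natDegree_pos
    omega
  set t := s * aeval s k with ht
  have ht0 : t ≠ 0 := fun h0 => absurd (hmin k hk0 h0) (by omega)
  have htC : InC f t := hsC.of_comm (hcs k)
  have hts : σ t = t := by rw [ht, h.mul, hI, hss, (hcs k).eq]
  have hπt : aeval s π * t = 0 := by
    rw [ht, ← mul_assoc, ← (hcs π).eq, mul_assoc, ← map_mul, ← hk, hg]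
  have htk : t = aeval s (X * k) := by rw [ht, map_mul, aeval_X]
  have hnd : ¬ π ∣ X * k := by
    rintro ⟨l, hl⟩
    apply ht0
    apply key t htC hts
    nth_rw 1 [htk, hl, map_mul, hcomm]
    rw [mul_assoc, hπt, mul_zero]
  obtain ⟨a, b, hab⟩ := (Irreducible.coprime_iff_not_dvd hπ).2 hnd
  have hone : aeval s a * aeval s π + aeval s b * t = 1 := by
    rw [htk, ← map_mul, ← map_mul, ← map_add, hab, map_one]
  set ε := aeval s b * t with hε
  have hbt : Commute t (aeval s b) := by rw [htk]; exact hcomm _ _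
  have hεC : InC f ε := by rw [hε, ← hbt.eq]; exact htC.of_comm hbt
  have hεs : σ ε = ε := by rw [hε, h.mul, hts, hI, hss, hbt.eq]
  have hπε : aeval s π * ε = 0 := by
    rw [hε, ← mul_assoc, hcomm, mul_assoc, hπt, mul_zero]
  have hεε : ε * ε = ε := by
    have : 1 * ε = ε := one_mul _
    rw [← hone, add_mul, mul_assoc, hπε, mul_zero, zero_add] at this
    exact this
  have hε0 : ε ≠ 0 := by
    intro h0
    rw [h0, add_zero] at hone
    apply ht0
    rw [← one_mul t, ← hone, mul_assoc, hπt, mul_zero]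
  have hεeq : ε = aeval s (b * (X * k)) := by rw [map_mul, ← htk]
  have hsε : Commute s ε := by rw [hεeq]; exact hcs _
  rcases hL.irr π hπm hπ with ⟨c, rfl⟩ | ⟨α, β, hβ, rfl⟩
  · have h1 : s * ε = c • ε := by
      simp only [map_sub, aeval_X, aeval_C, sub_mul, sub_eq_zero] at hπε
      rw [hπε, Algebra.algebraMap_eq_smul_one, smul_mul_assoc, one_mul]
    refine ⟨c, ε, ?_, hεC, hεs, hεε, hε0, h1, by rw [← hsε.eq, h1]⟩
    rintro rfl
    apply hnd
    simp
  · exfalso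
    set w := s - algebraMap L S α with hw
    have hwε : Commute w ε := hsε.sub_left (Algebra.commutes α ε)
    have hπε' : w * w * ε = - (β ^ 2) • ε := by
      simp only [map_add, map_pow, map_sub, aeval_X, aeval_C, add_mul] at hπε
      rw [← hw, sq] at hπε
      rw [eq_neg_of_add_eq_zero_left hπε, Algebra.smul_def]; simp
    have hσw : σ w = w := by rw [hw, h.sub, hss, h.algebraMap hs]
    have e1 : (w * ε) * (w * ε) = - (β ^ 2) • ε := by
      rw [mul_assoc, ← mul_assoc ε, ← hwε.eq, mul_assoc, hεε, ← mul_assoc, hπε']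
    have e2 : (β⁻¹ • (w * ε)) * (β⁻¹ • (w * ε)) = - ε := by
      rw [smul_mul_assoc, mul_smul_comm, e1, smul_smul, smul_smul]
      have : β⁻¹ * β⁻¹ * -β ^ 2 = -1 := by field_simp
      rw [this, neg_smul, one_smul]
    have e3 : σ (β⁻¹ • (w * ε)) = β⁻¹ • (w * ε) := by
      rw [hs, h.mul, hεs, hσw, hwε.eq]
    refine hnb ε (β⁻¹ • (w * ε)) hεC hεs hεε hε0 ?_ ?_ (by rw [e3, e2]) (by rw [e3, e2])
    · rw [mul_smul_comm, hwε.eq, ← mul_assoc, hεε]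
    · rw [smul_mul_assoc, mul_assoc, hεε]
end
end Part5

section Part6
section
variable {L : Type*} [Field L] {S : Type*} [Ring S] [Algebra L S]
  {σ : S → S} {f : S}

theorem eig_pos [FiniteDimensional L S] [IsSemisimpleRing S] (k2 : (2 : L) ≠ 0) (hL : RCF L)
    (h : IsInvo σ)
    (hs : ∀ (c : L) x, σ (c • x) = c • σ x) (hf : σ f = f) (hff : f * f = f)
    (hnb : NB σ f) {x ε : S} {c : L} (hx : InC f x) (hεC : InC f ε)
    (hεs : σ ε = ε) (hεε : ε * ε = ε) (hε0 : ε ≠ 0) (hc0 : c ≠ 0)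
    (hc : σ x * x * ε = c • ε) : IsSquare c := by
  by_contra hcs
  obtain ⟨d, hd⟩ := (hL.sq c).resolve_left hcs
  have hd0 : d ≠ 0 := by rintro rfl; simp at hd; exact hc0 hd
  have key : ∀ (ε z : S) (c : L), InC f ε → σ ε = ε → ε * ε = ε → ε ≠ 0 → InC f z →
      σ z * z = - ε → ε * z + σ z * ε = c • ε → False := by
    intro ε z c hεC hεs hεε hε0 hz h1 h2
    obtain ⟨r, hr⟩ := hL.add (c * c) (2 * 2) ⟨c, rfl⟩ ⟨2, rfl⟩
    set β := (c + r) / 2 with hβ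
    have hb : 1 + β * c - β * β = 0 := by
      rw [hβ]; field_simp; linear_combination hr
    have hv : σ (ε + β • z) * (ε + β • z) = 0 := by
      rw [h.add, hs, hεs, add_mul, mul_add, mul_add, hεε, smul_mul_smul_comm, h1, mul_smul_comm,
        smul_mul_assoc]
      have : ε + β • (ε * z) + (β • (σ z * ε) + (β * β) • -ε)
        = ε + β • (ε * z + σ z * ε) + (β * β) • -ε := by rw [smul_add]; abel
      rw [this, h2, smul_smul]
      have : ε + (β * c) • ε + (β * β) • -ε = (1 + β * c - β * β) • ε := by
        rw [sub_smul, add_smul, one_smul, smul_neg]; abel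
      rw [this, hb, zero_smul]
    have hv0 := aniso h hf hff hnb (hεC.add (hz.smul β)) hv
    have e1 : ε = - (β • z) := eq_neg_of_add_eq_zero_left hv0
    have e2 : ε = -(β • σ z) := by rw [← hs, ← h.neg, ← e1, hεs]
    have e3 : ε = (β * β) • - ε := by
      conv_lhs => rw [← hεε]
      nth_rw 1 [e2]
      nth_rw 1 [e1]
      rw [neg_mul_neg, smul_mul_smul_comm, h1]
    have e4 : (1 + β * β) • ε = 0 := by
      rw [add_smul, one_smul]; nth_rw 1 [e3]; rw [smul_neg]; abel
    have e5 := (smul_eq_zero.1 e4).resolve_right hε0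
    exact hL.neg ⟨β, by linear_combination -e5⟩
  set z := d⁻¹ • (x * ε) with hz
  have hzC : InC f z := (hx.mul hεC).smul _
  have hzz : σ z * z = - ε := by
    rw [hz, hs, smul_mul_smul_comm, h.mul, hεs]
    have : ε * σ x * (x * ε) = ε * (σ x * x * ε) := by simp only [mul_assoc]
    rw [this, hc, mul_smul_comm, hεε, smul_smul]
    have : d⁻¹ * d⁻¹ * c = -1 := by field_simp; linear_combination -hd
    rw [this, neg_smul, one_smul]
  have hzε : z * ε = z := by rw [hz, smul_mul_assoc, mul_assoc, hεε]
  have hεz : ε * σ z = σ z := by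
    conv_lhs => rw [← hεs]
    rw [← h.mul, hzε]
  set t := ε * z + σ z * ε with ht
  by_cases ht0 : t = 0
  · exact key ε z 0 hεC hεs hεε hε0 hzC hzz (by rw [← ht, ht0, zero_smul])
  · have htC : InC f t := (hεC.mul hzC).add ((hzC.invo h hf).mul hεC)
    have hts : σ t = t := by
      rw [ht, h.add, h.mul, h.mul, h.inv, hεs, add_comm]
    obtain ⟨c', ε', hc', h1, h2, h3, h4, h5, h6⟩ := eig hL h hs hf hff hnb htC hts ht0
    have hεt : ε * t = t := by
      rw [ht, mul_add, ← mul_assoc, hεε, ← mul_assoc, hεz]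
    have hle : ε * ε' = ε' := by
      have : ε * (c' • ε') = c' • ε' := by rw [← h5, ← mul_assoc, hεt]
      rw [mul_smul_comm] at this
      exact smul_right_injective S hc' this
    have hle' : ε' * ε = ε' := by
      have := congrArg σ hle
      rwa [h.mul, hεs, h2] at this
    refine key ε' (z * ε') c' h1 h2 h3 h4 (hzC.mul h1) ?_ ?_
    · rw [h.mul, h2, mul_assoc, ← mul_assoc (σ z), hzz, neg_mul, hle, mul_neg, h3]
    · rw [h.mul, h2]
      calc ε' * (z * ε') + ε' * σ z * ε' = ε' * ε * (z * ε') + ε' * σ z * (ε * ε') := by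
            rw [hle, hle']
        _ = ε' * t * ε' := by rw [ht]; noncomm_ring
        _ = c' • ε' := by rw [h6, smul_mul_assoc, h3]

theorem tau_pos [FiniteDimensional L S] [IsSemisimpleRing S] (hL : RCF L)
    (h : IsInvo σ)
    (hs : ∀ (c : L) x, σ (c • x) = c • σ x) (hf : σ f = f) (hff : f * f = f)
    (hnb : NB σ f) (τ : S →ₗ[L] L)
    (hτ : ∀ ε, ε * ε = ε → ε ≠ 0 → τ ε ∈ hL.ordering.carrier) :
    ∀ (n : ℕ) (y : S), finrank L (LinearMap.range (LinearMap.mulLeft L y)) ≤ n → InC f y →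
      σ y = y → y ≠ 0 →
      (∀ (c : L) (ε : S), c ≠ 0 → InC f ε → σ ε = ε → ε * ε = ε → ε ≠ 0 → y * ε = c • ε →
        IsSquare c) → τ y ∈ hL.ordering.carrier := by
  intro n
  induction n with
  | zero =>
    intro y hn _ _ hy0
    exfalso
    have : LinearMap.range (LinearMap.mulLeft L y) = ⊥ := Submodule.finrank_eq_zero.1 (by omega)
    rw [LinearMap.range_eq_bot] at this
    apply hy0
    have := congrFun (congrArg DFunLike.coe this) 1
    simpa using this
  | succ n ih =>
    intro y hn hyC hys hy0 hy
    obtain ⟨c, ε, hc, h1, h2, h3, h4, h5, h6⟩ := eig hL h hs hf hff hnb hyC hys hy0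
    have hcsq := hy c ε hc h1 h2 h3 h4 h5
    have hpos : τ (c • ε) ∈ hL.ordering.carrier := by
      rw [map_smul]; exact hL.ordering.mul_mem' ⟨hc, hcsq⟩ (hτ ε h3 h4)
    by_cases hy' : y - c • ε = 0
    · rw [sub_eq_zero.1 hy']; exact hpos
    · have e0 : ε * (y - c • ε) = 0 := by rw [mul_sub, h6, mul_smul_comm, h3, sub_self]
      have := ih (y - c • ε) ?_ (hyC.sub (h1.smul c)) (by rw [h.sub, hys, hs, h2]) hy' ?_
      · have h7 := hL.ordering.add_mem' this hpos
        rwa [← map_add, sub_add_cancel] at h7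
      · suffices finrank L (LinearMap.range (LinearMap.mulLeft L (y - c • ε))) <
          finrank L (LinearMap.range (LinearMap.mulLeft L y)) by omega
        apply Submodule.finrank_lt_finrank_of_lt
        refine lt_of_le_of_ne ?_ ?_
        · rintro _ ⟨a, rfl⟩
          refine ⟨a - ε * a, ?_⟩
          simp only [LinearMap.mulLeft_apply, mul_sub, sub_mul]
          rw [← mul_assoc, h5]
        · intro heq
          have : c • ε ∈ LinearMap.range (LinearMap.mulLeft L (y - c • ε)) := by
            rw [heq, ← h5]; exact ⟨ε, rfl⟩
          obtain ⟨a, ha⟩ := this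
          have h8 := congrArg (ε * ·) ha
          simp only [LinearMap.mulLeft_apply] at h8
          rw [← mul_assoc, e0, zero_mul, mul_smul_comm, h3] at h8
          exact h4 ((smul_eq_zero.1 h8.symm).resolve_left hc)
      · intro c' ε' hc' i1 i2 i3 i4 i5
        refine hy c' ε' hc' i1 i2 i3 i4 ?_
        have : ε * ε' = 0 := by
          have h8 : ε * (c' • ε') = 0 := by rw [← i5, ← mul_assoc, e0, zero_mul]
          rw [mul_smul_comm] at h8
          exact (smul_eq_zero.1 h8).resolve_left hc'
        rw [sub_mul, smul_mul_assoc, this, smul_zero, sub_zero] at i5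
        exact i5

theorem corner_pos [FiniteDimensional L S] [IsSemisimpleRing S] (k2 : (2 : L) ≠ 0) (hL : RCF L)
    (h : IsInvo σ)
    (hs : ∀ (c : L) x, σ (c • x) = c • σ x) (hf : σ f = f) (hff : f * f = f)
    (hnb : NB σ f) (τ : S →ₗ[L] L)
    (hτ : ∀ ε, ε * ε = ε → ε ≠ 0 → τ ε ∈ hL.ordering.carrier) {x : S} (hx : InC f x)
    (hx0 : x ≠ 0) : τ (σ x * x) ∈ hL.ordering.carrier := by
  refine tau_pos hL h hs hf hff hnb τ hτ _ (σ x * x) le_rfl ((hx.invo h hf).mul hx)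
    (by rw [h.mul, h.inv]) (fun h0 => hx0 (aniso h hf hff hnb hx h0)) ?_
  intro c ε hc h1 h2 h3 h4 h5
  exact eig_pos k2 hL h hs hf hff hnb hx h1 h2 h3 h4 hc h5

theorem exists_max [FiniteDimensional L S] (h : IsInvo σ) :
    ∃ e x : S, σ e = e ∧ e * e = e ∧ e * x = x ∧ x * e = x ∧ σ x * x = - e ∧ x * σ x = - e ∧
      NB σ (1 - e) := by
  let P : ℕ → Prop := fun n => ∃ e x : S, σ e = e ∧ e * e = e ∧ e * x = x ∧ x * e = x ∧
    σ x * x = - e ∧ x * σ x = - e ∧ finrank L (LinearMap.range (LinearMap.mulLeft L e)) = n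
  have hP0 : ∃ n, P n := ⟨_, 0, 0, h.zero, by simp, by simp, by simp, by simp, by simp, rfl⟩
  have hb : ∀ n, P n → n ≤ finrank L S := by
    rintro n ⟨e, x, -, -, -, -, -, -, rfl⟩
    exact Submodule.finrank_le _
  classical
  obtain ⟨n, hn⟩ := hP0
  have hspec := Nat.findGreatest_spec (hb n hn) hn
  obtain ⟨e, x, h1, h2, h3, h4, h5, h6, h7⟩ := hspec
  refine ⟨e, x, h1, h2, h3, h4, h5, h6, ?_⟩
  intro ε z hεC i1 i2 i3 i4 i5 i6 i7
  have heε : e * ε = 0 := by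
    have := hεC.l
    rw [sub_mul, one_mul] at this
    simpa using this
  have hεe : ε * e = 0 := by
    have := hεC.r
    rw [mul_sub, mul_one] at this
    simpa using this
  have hσx1 : σ x * e = σ x := by conv_lhs => rw [← h1]
                                  rw [← h.mul, h3]
  have hσx2 : e * σ x = σ x := by conv_lhs => rw [← h1]
                                  rw [← h.mul, h4]
  have hσz1 : σ z * ε = σ z := by conv_lhs => rw [← i1]
                                  rw [← h.mul, i4]
  have hσz2 : ε * σ z = σ z := by conv_lhs => rw [← i1]
                                  rw [← h.mul, i5]
  have c1 : e * z = 0 := by rw [← i4, ← mul_assoc, heε, zero_mul]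
  have c2 : z * e = 0 := by rw [← i5, mul_assoc, hεe, mul_zero]
  have c3 : ε * x = 0 := by rw [← h3, ← mul_assoc, hεe, zero_mul]
  have c4 : x * ε = 0 := by rw [← h4, mul_assoc, heε, mul_zero]
  have c5 : σ x * z = 0 := by rw [← hσx1, mul_assoc, c1, mul_zero]
  have c6 : σ z * x = 0 := by rw [← hσz1, mul_assoc, c3, mul_zero]
  have c7 : x * σ z = 0 := by rw [← hσz2, ← mul_assoc, c4, zero_mul]
  have c8 : z * σ x = 0 := by rw [← hσx2, ← mul_assoc, c2, zero_mul]
  have hlt : finrank L (LinearMap.range (LinearMap.mulLeft L e)) <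
      finrank L (LinearMap.range (LinearMap.mulLeft L (e + ε))) := by
    apply Submodule.finrank_lt_finrank_of_lt
    refine lt_of_le_of_ne ?_ ?_
    · rintro _ ⟨a, rfl⟩
      refine ⟨e * a, ?_⟩
      simp only [LinearMap.mulLeft_apply, add_mul]
      rw [← mul_assoc, h2, ← mul_assoc, hεe, zero_mul, add_zero]
    · intro heq
      have : ε ∈ LinearMap.range (LinearMap.mulLeft L e) := by
        rw [heq]; exact ⟨ε, by simp [add_mul, heε, i2]⟩
      obtain ⟨a, ha⟩ := this
      simp only [LinearMap.mulLeft_apply] at ha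
      rw [← ha, ← mul_assoc, h2] at heε
      exact i3 (by rw [← ha, heε])
  have hPn : P (finrank L (LinearMap.range (LinearMap.mulLeft L (e + ε)))) := by
    refine ⟨e + ε, x + z, ?_, ?_, ?_, ?_, ?_, ?_, rfl⟩
    · rw [h.add, h1, i1]
    · simp [mul_add, add_mul, h2, i2, heε, hεe]
    · simp [mul_add, add_mul, h3, i4, c1, c3]
    · simp [mul_add, add_mul, h4, i5, c2, c4]
    · rw [h.add]; simp only [mul_add, add_mul, h5, i6, c5, c6]; abel
    · rw [h.add]; simp only [mul_add, add_mul, h6, i7, c7, c8]; abel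
  have := Nat.le_findGreatest (hb _ hPn) hPn
  omega
end
end Part6

section Part7
theorem FieldOrdering.natCast_mem {K : Type*} [Field K] (O : FieldOrdering K) {n : ℕ} (hn : 0 < n) :
    (n : K) ∈ O.carrier := by
  obtain ⟨m, rfl⟩ := Nat.exists_eq_succ_of_ne_zero hn.ne'
  clear hn
  have h1 : (1 : K) ∈ O.carrier := by simpa using O.sq_mem (one_ne_zero (α := K))
  induction m with
  | zero => simpa using h1
  | succ m ih => rw [Nat.cast_succ]; exact O.add_mem' ih h1

section
variable {L : Type*} [Field L]

theorem tau_calc {S : Type*} [Ring S] [Algebra L S] {σ : S → S} (h : IsInvo σ) (τ : S →ₗ[L] L)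
    (hτ : ∀ a b, τ (a * b) = τ (b * a)) {e x : S} (he : σ e = e) (hee : e * e = e)
    (hex : e * x = x) (hxe : x * e = x) (hx1 : σ x * x = -e) (hx2 : x * σ x = -e)
    {a w y c : S} (hw : w = a - (1 - e) * a * (1 - e)) (hc : InC (1 - e) c)
    (hy : y = x * w + (1 - e) * w * x + c) :
    τ (σ y * y) = - τ (σ a * a) + τ (σ ((1 - e) * a * (1 - e)) * ((1 - e) * a * (1 - e))) +
      τ (σ c * c) := by
  set f := 1 - e with hf
  have hff : f * f = f := by rw [hf]; simp [mul_sub, sub_mul, hee]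
  have hσf : σ f = f := by rw [hf, h.sub, h.one, he]
  have hef : e * f = 0 := by rw [hf]; simp [mul_sub, hee]
  have hfe : f * e = 0 := by rw [hf]; simp [sub_mul, hee]
  have h1 : e + f = 1 := by rw [hf]; abel
  clear_value f
  have hfwf : f * w * f = 0 := by
    rw [hw, mul_sub, sub_mul]
    have : f * (f * a * f) * f = (f * f) * a * (f * f) := by noncomm_ring
    rw [this, hff, sub_self]
  have hfσw : f * σ w * f = 0 := by
    have := congrArg σ hfwf
    rw [h.mul, h.mul, hσf, h.zero, ← mul_assoc] at this
    exact this
  set d := f * a * f with hd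
  have haw : a = w + d := by rw [hw]; abel
  have hfx : f * x = 0 := by rw [← hex, ← mul_assoc, hfe, zero_mul]
  have hxf : x * f = 0 := by rw [← hxe, mul_assoc, hef, mul_zero]
  have hσxf : σ x * f = 0 := by
    have := congrArg σ hfx
    rwa [h.mul, hσf, h.zero] at this
  have hfσx : f * σ x = 0 := by
    have := congrArg σ hxf
    rwa [h.mul, hσf, h.zero] at this
  have hσc := hc.invo h hσf
  have t1 : τ (σ a * a) = τ (σ w * w) + τ (σ d * d) := by
    have e1 : τ (σ w * d) = 0 := by
      rw [hd, ← mul_assoc, hτ, ← mul_assoc, ← mul_assoc, hfσw]; simp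
    have e2 : τ (σ d * w) = 0 := by
      rw [hd, h.mul, h.mul, hσf, mul_assoc, hτ]
      have : σ a * f * w * f = σ a * (f * w * f) := by noncomm_ring
      rw [this, hfwf]; simp
    conv_lhs => rw [haw]
    rw [h.add, add_mul, mul_add, mul_add, map_add, map_add, map_add, e1, e2]; ring
  have m1 : σ (x * w) * (x * w) = - (σ w * e * w) := by
    rw [h.mul, mul_assoc, ← mul_assoc (σ x), hx1]; noncomm_ring
  have m2 : τ (σ (f * w * x) * (f * w * x)) = - τ (σ w * f * w) := by
    have e0 : σ w * f * w = σ w * f * w * e := by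
      have : σ w * f * w * (e + f) = σ w * f * w * e + σ w * (f * w * f) := by noncomm_ring
      rw [h1, hfwf] at this; simpa using this
    rw [h.mul, h.mul, hσf]
    have : σ x * (σ w * f) * (f * w * x) = σ x * (σ w * (f * f) * w * x) := by noncomm_ring
    rw [this, hff, hτ, mul_assoc, hx2, e0, mul_neg, map_neg]
    have : σ w * f * w * e * e = σ w * f * w * (e * e) := by noncomm_ring
    congr 2
    rw [mul_assoc _ e e, hee]
  have c1 : σ (x * w) * (f * w * x) = 0 := by
    rw [h.mul]
    have : σ w * σ x * (f * w * x) = σ w * (σ x * f) * (w * x) := by noncomm_ring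
    rw [this, hσxf]; simp
  have c2 : σ (f * w * x) * (x * w) = 0 := by
    rw [h.mul, h.mul, hσf]
    have : σ x * (σ w * f) * (x * w) = σ x * σ w * (f * x) * w := by noncomm_ring
    rw [this, hfx]; simp
  have c3 : σ (x * w) * c = 0 := by
    rw [h.mul, ← hc.l]
    have : σ w * σ x * (f * c) = σ w * (σ x * f) * c := by noncomm_ring
    rw [this, hσxf]; simp
  have c4 : σ c * (x * w) = 0 := by
    rw [← hσc.r]
    have : σ c * f * (x * w) = σ c * (f * x) * w := by noncomm_ring
    rw [this, hfx]; simp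
  have c5 : τ (σ (f * w * x) * c) = 0 := by
    rw [h.mul, h.mul, hσf, hτ, ← mul_assoc]
    nth_rw 1 [← hc.r]
    rw [mul_assoc c, hfσx]; simp
  have c6 : τ (σ c * (f * w * x)) = 0 := by
    rw [hτ, ← hσc.l, mul_assoc, ← mul_assoc x, hxf]; simp
  have : σ w * w = σ w * e * w + σ w * f * w := by
    rw [← add_mul, ← mul_add, h1, mul_one]
  rw [t1, this, hy, h.add, h.add]
  simp only [add_mul, mul_add, map_add]
  rw [c1, c2, c3, c4, m1, m2, c5, c6]
  simp only [map_neg, map_zero]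
  ring

def cornerSub (L : Type*) [Field L] {S : Type*} [Ring S] [Algebra L S] (f : S) : Submodule L S where
  carrier := {c | InC f c}
  add_mem' ha hb := ha.add hb
  zero_mem' := ⟨by simp, by simp⟩
  smul_mem' c _ ha := ha.smul c

theorem rc {A : Type u} [Ring A] [Algebra L A] [FiniteDimensional L A] {σ : A → A}
    (k2 : (2 : L) ≠ 0) (hL : RCF L) (h : IsInvo σ) (hs : ∀ (c : L) x, σ (c • x) = c • σ x)
    (hsig : signatureAt hL.ordering (involutionTraceForm L σ) = 0) :
    HypG (K := L) σ (1 : Matrix (Unit ⊕ Unit) (Unit ⊕ Unit) L) := by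
  classical
  obtain ⟨S, _, _, _, _, π, σ', h', hs', hπ, hc, hnil⟩ := exists_semisimple_quot h hs
  set O := hL.ordering with hO
  let τ0 : A →ₗ[L] L := (LinearMap.trace L A).comp (LinearMap.mul L A)
  have hτ0 : ∀ x, τ0 x = LinearMap.trace L A (LinearMap.mulLeft L x) := fun x => rfl
  have hτ0c : ∀ a b, τ0 (a * b) = τ0 (b * a) := by
    intro a b
    rw [hτ0, hτ0, LinearMap.mulLeft_mul, LinearMap.mulLeft_mul]
    exact LinearMap.trace_mul_comm L (LinearMap.mulLeft L a) (LinearMap.mulLeft L b)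
  have hτ0n : ∀ x, π x = 0 → τ0 x = 0 := by
    intro x hx
    obtain ⟨n, hn⟩ := hnil x hx
    have : IsNilpotent (LinearMap.mulLeft L x) := ⟨n, by rw [LinearMap.pow_mulLeft, hn]; ext; simp⟩
    have := LinearMap.isNilpotent_trace_of_isNilpotent this
    exact this.eq_zero
  obtain ⟨sec, hsec⟩ := LinearMap.exists_rightInverse_of_surjective π.toLinearMap
    (LinearMap.range_eq_top.2 hπ)
  have hsec' : ∀ y, π (sec y) = y := fun y => congrFun (congrArg DFunLike.coe hsec) y
  let τ : S →ₗ[L] L := τ0.comp sec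
  have hτπ : ∀ x, τ (π x) = τ0 x := by
    intro x
    have : τ0 (sec (π x) - x) = 0 := hτ0n _ (by rw [map_sub, hsec', sub_self])
    rw [map_sub, sub_eq_zero] at this
    exact this
  have hτc : ∀ a b, τ (a * b) = τ (b * a) := by
    intro a b
    obtain ⟨a, rfl⟩ := hπ a
    obtain ⟨b, rfl⟩ := hπ b
    rw [← map_mul, ← map_mul, hτπ, hτπ, hτ0c]
  have hq : ∀ v, involutionTraceForm L σ v = τ (σ' (π v) * π v) := by
    intro v; rw [hc, ← map_mul, hτπ]; rfl
  have hτid : ∀ ε, ε * ε = ε → ε ≠ 0 → τ ε ∈ O.carrier := by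
    intro ε hε hε0
    obtain ⟨a, ha, rfl⟩ := exists_isIdempotentElem_eq_of_ker_isNilpotent π.toRingHom
      (fun x hx => hnil x hx) ε (by obtain ⟨a, rfl⟩ := hπ ε; exact ⟨a, rfl⟩) hε
    change τ (π a) ∈ _
    have ha0 : a ≠ 0 := by rintro rfl; exact hε0 (by simp)
    have hproj : LinearMap.IsProj (LinearMap.range (LinearMap.mulLeft L a))
        (LinearMap.mulLeft L a) := by
      refine ⟨fun x => ⟨x, rfl⟩, ?_⟩
      rintro _ ⟨y, rfl⟩
      simp only [LinearMap.mulLeft_apply]; rw [← mul_assoc, ha]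
    rw [hτπ, hτ0, hproj.trace]
    apply O.natCast_mem
    have : Nontrivial (LinearMap.range (LinearMap.mulLeft L a)) :=
      ⟨⟨⟨a, 1, by simp⟩, 0, fun h0 => ha0 (congrArg Subtype.val h0)⟩⟩
    exact Module.finrank_pos
  obtain ⟨e, x, i1, i2, i3, i4, i5, i6, hnb⟩ := exists_max (L := L) h'
  have hfs : σ' (1 - e) = 1 - e := by rw [h'.sub, h'.one, i1]
  have hff : (1 - e) * (1 - e) = 1 - e := by simp [mul_sub, sub_mul, i2]
  have hCpos : ∀ c, InC (1 - e) c → c ≠ 0 → τ (σ' c * c) ∈ O.carrier := fun c hcC hc0 =>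
    corner_pos k2 hL h' hs' hfs hff hnb τ hτid hcC hc0
  have hCnn : ∀ c, InC (1 - e) c → O.nn (τ (σ' c * c)) := by
    intro c hcC
    by_cases hc0 : c = 0
    · left; rw [hc0]; simp
    · right; exact hCpos c hcC hc0
  -- the signature
  obtain ⟨b, w, hbw⟩ := exists_diag k2 h hs
  have hp := posDims_greatest O b w _ hbw
  have hn := posDims_greatest O b (fun i => - w i) (fun v => - involutionTraceForm L σ v) (fun v => by
      rw [hbw, ← Finset.sum_neg_distrib]; simp)
  rw [signatureAt_eq, hp.csSup_eq, hn.csSup_eq, sub_eq_zero, Nat.cast_inj] at hsig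
  rw [← hsig] at hn
  obtain ⟨N, hN, hNneg⟩ := hn.1
  let φ0 : N →ₗ[L] S := π.toLinearMap.comp N.subtype
  let f := 1 - e
  let φw : N →ₗ[L] S := φ0 - (LinearMap.mulRight L f).comp ((LinearMap.mulLeft L f).comp φ0)
  let φ : N × cornerSub L f →ₗ[L] A := sec.comp
    (((LinearMap.mulLeft L x).comp φw +
      (LinearMap.mulRight L x).comp ((LinearMap.mulLeft L f).comp φw)).coprod
        (cornerSub L f).subtype)
  have hφ : ∀ v : N, ∀ c : cornerSub L f, involutionTraceForm L σ (φ (v, c)) =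
      - involutionTraceForm L σ v + τ (σ' (f * π v * f) * (f * π v * f)) + τ (σ' c * c) := by
    intro v c
    rw [hq, hq]
    exact tau_calc h' τ hτc i1 i2 i3 i4 i5 i6 (a := π v) (w := φw v) rfl c.2 (by
      change π (sec _) = _
      rw [hsec']; rfl)
  have hffC : ∀ a : S, InC f (f * a * f) := fun a =>
    ⟨by rw [← mul_assoc, ← mul_assoc, hff], by rw [mul_assoc, hff]⟩
  have hφpos : ∀ z, z ≠ 0 → involutionTraceForm L σ (φ z) ∈ O.carrier := by
    rintro ⟨v, c⟩ hz
    rw [hφ]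
    by_cases hv : v = 0
    · subst hv
      have hc0 : (c : S) ≠ 0 := by
        intro hc0; apply hz; ext <;> simp [hc0]
      have : involutionTraceForm L σ ((0 : N) : A) = 0 := by rw [hq]; simp
      rw [this]
      simp only [ZeroMemClass.coe_zero, map_zero, mul_zero, zero_mul, neg_zero, zero_add]
      exact hCpos _ c.2 hc0
    · exact O.add_mem_nn (O.add_mem_nn (hNneg v v.2 (by simpa using hv)) (hCnn _ (hffC _)))
        (hCnn _ c.2)
  have hφinj : Function.Injective φ := by
    rw [← LinearMap.ker_eq_bot, LinearMap.ker_eq_bot']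
    intro z hz
    by_contra hz0
    have := hφpos z hz0
    rw [hz, hq] at this
    simp only [map_zero, mul_zero] at this
    exact O.zero_notMem this
  have hle := hp.2 ⟨LinearMap.range φ, rfl, by
    rintro _ ⟨z, rfl⟩ hz
    exact hφpos z (by rintro rfl; simp at hz)⟩
  rw [LinearMap.finrank_range_of_inj hφinj, Module.finrank_prod, hN] at hle
  have hC0 : finrank L (cornerSub L f) = 0 := by omega
  rw [Submodule.finrank_eq_zero] at hC0
  have hf0 : f = 0 := by
    have : f ∈ cornerSub L f := ⟨hff, hff⟩
    rw [hC0] at this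
    exact this
  have he1 : e = 1 := (sub_eq_zero.1 hf0).symm
  subst he1
  -- lift
  obtain ⟨y, rfl⟩ := hπ x
  obtain ⟨g, hg⟩ := exists_invsqrt' k2 (j := - (σ y * y) - 1) (hnil _ (by
    rw [map_sub, map_neg, map_mul, ← hc, i5]; simp))
  set r := Polynomial.aeval (- (σ y * y) - 1) g with hr
  have hσr : σ r = r := by
    rw [hr, h.aeval hs, h.sub, h.neg, h.mul, h.inv, h.one]
  have hcr : Commute (σ y * y) r := by
    refine commute_aeval_r g ?_
    exact ((Commute.refl _).neg_right).sub_right (Commute.one_right _)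
  have hz1 : σ (y * r) * (y * r) = -1 := by
    rw [h.mul, hσr]
    have : r * σ y * (y * r) = r * (σ y * y * r) := by noncomm_ring
    rw [this, hcr.eq, ← mul_assoc, ← sq]
    have : 1 + (-(σ y * y) - 1) = -(σ y * y) := by abel
    rw [this, mul_neg] at hg
    rw [← hg, neg_neg]
  set z := y * r
  have hz2 : z * σ z = -1 := by
    have : IsArtinianRing A := IsArtinianRing.of_finite L A
    have h1 : (-σ z) * z = 1 := by rw [neg_mul, hz1, neg_neg]
    have h2 := mul_eq_one_symm h1
    rw [mul_neg] at h2
    rw [← h2, neg_neg]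
  rw [hypG_one_iff]
  refine ⟨Matrix.fromBlocks 0 (Matrix.of fun _ _ => z) (Matrix.of fun _ _ => - σ z) 0, ?_, ?_⟩
  · rw [← Matrix.fromBlocks_one, Matrix.fromBlocks_multiply]
    congr 1
    · ext; simp [Matrix.mul_apply, hz2]
    · simp
    · simp
    · ext; simp [Matrix.mul_apply, hz1]
  · ext (i | i) (j | j) <;> simp [conjT_apply, h.zero, h.neg, h.inv]
end
end Part7

section Part8
open Polynomial

theorem no_quad {F E : Type*} [Field F] [Field E] [Algebra F E] [FiniteDimensional F E]
    [IsGalois F E] (k2 : (2 : F) ≠ 0) (hsq : ∀ a : F, IsSquare a) {m : ℕ}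
    (hm : finrank F E = 2 ^ m) : m = 0 := by
  by_contra hm0
  obtain ⟨k, rfl⟩ := Nat.exists_eq_succ_of_ne_zero hm0
  have : Fact (Nat.Prime 2) := ⟨Nat.prime_two⟩
  obtain ⟨H, hH⟩ := Sylow.exists_subgroup_card_pow_prime (G := Gal(E/F)) 2 (n := k) (by
    rw [IsGalois.card_aut_eq_finrank, hm, pow_succ]; exact Dvd.intro _ rfl)
  have h1 := IntermediateField.finrank_fixedField_eq_card H
  have h2 := Module.finrank_mul_finrank F (IntermediateField.fixedField H) E
  rw [h1, hH, hm, pow_succ, mul_comm] at h2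
  have h3 : finrank F (IntermediateField.fixedField H) = 2 :=
    Nat.eq_of_mul_eq_mul_left (by positivity) h2
  set M := IntermediateField.fixedField H
  obtain ⟨α, hα⟩ := Field.exists_primitive_element F M
  rw [Field.primitive_element_iff_minpoly_natDegree_eq, h3] at hα
  have hmon := minpoly.monic (IsIntegral.of_finite F α)
  have hq := minpoly.aeval F α
  rw [hmon.as_sum, hα] at hq
  simp only [Finset.sum_range_succ, Finset.sum_range_zero, map_add, map_pow, map_mul, aeval_X,
    aeval_C, pow_zero, pow_one, mul_one, zero_add] at hq
  set c0 := (minpoly F α).coeff 0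
  set c1 := (minpoly F α).coeff 1
  obtain ⟨d, hd⟩ := hsq (c1 ^ 2 - 4 * c0)
  have k2' : (2 : M) ≠ 0 := by
    intro h0; apply k2
    apply (algebraMap F M).injective; rw [map_ofNat, h0, map_zero]
  have hd' := congrArg (algebraMap F M) hd
  simp only [map_sub, map_pow, map_mul, map_ofNat] at hd'
  have hprod : (2 * α + algebraMap F M c1 - algebraMap F M d) *
      (2 * α + algebraMap F M c1 + algebraMap F M d) = 0 := by
    linear_combination 4 * hq + hd'
  have hmem : ∃ t : F, algebraMap F M t = α := by
    rcases mul_eq_zero.1 hprod with h0 | h0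
    · refine ⟨(d - c1) / 2, ?_⟩
      rw [map_div₀, map_sub, map_ofNat, div_eq_iff k2']
      linear_combination -h0
    · refine ⟨(-d - c1) / 2, ?_⟩
      rw [map_div₀, map_sub, map_neg, map_ofNat, div_eq_iff k2']
      linear_combination -h0
  obtain ⟨t, rfl⟩ := hmem
  rw [minpoly.eq_X_sub_C, natDegree_X_sub_C] at hα
  omega

theorem two_pow {F E : Type*} [Field F] [Field E] [Algebra F E] [FiniteDimensional F E]
    [IsGalois F E]
    (hodd : ∀ p : F[X], p.Monic → Irreducible p → Odd p.natDegree → p.natDegree = 1) :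
    ∃ m, finrank F E = 2 ^ m := by
  have : Fact (Nat.Prime 2) := ⟨Nat.prime_two⟩
  obtain ⟨m, k, hk, hmk⟩ := Nat.exists_eq_two_pow_mul_odd (n := finrank F E) finrank_pos.ne'
  refine ⟨m, ?_⟩
  obtain ⟨H, hH⟩ := Sylow.exists_subgroup_card_pow_prime (G := Gal(E/F)) 2 (n := m) (by
    rw [IsGalois.card_aut_eq_finrank, hmk]; exact Dvd.intro _ rfl)
  have h1 := IntermediateField.finrank_fixedField_eq_card H
  have h2 := Module.finrank_mul_finrank F (IntermediateField.fixedField H) E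
  rw [h1, hH, hmk, mul_comm] at h2
  have h3 : finrank F (IntermediateField.fixedField H) = k :=
    Nat.eq_of_mul_eq_mul_left (by positivity) h2
  set M := IntermediateField.fixedField H
  obtain ⟨α, hα⟩ := Field.exists_primitive_element F M
  rw [Field.primitive_element_iff_minpoly_natDegree_eq, h3] at hα
  have := hodd _ (minpoly.monic (IsIntegral.of_finite F α))
    (minpoly.irreducible (IsIntegral.of_finite F α)) (by rw [hα]; exact hk)
  rw [hmk, ← hα, this, mul_one]

theorem sq_complex {L : Type*} [Field L] (k2 : (2 : L) ≠ 0)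
    (sq : ∀ a : L, IsSquare a ∨ IsSquare (-a))
    (add : ∀ a b : L, IsSquare a → IsSquare b → IsSquare (a + b)) (neg : ¬ IsSquare (-1 : L))
    (a b : L) : ∃ x y : L, x * x - y * y = a ∧ 2 * x * y = b := by
  have zero : b = 0 → ∃ x y : L, x * x - y * y = a ∧ 2 * x * y = b := by
    rintro rfl
    rcases sq a with ⟨s, hs⟩ | ⟨s, hs⟩
    · exact ⟨s, 0, by rw [hs]; ring, by ring⟩
    · exact ⟨0, s, by linear_combination hs, by ring⟩
  obtain ⟨r, hr⟩ := add (a * a) (b * b) ⟨a, rfl⟩ ⟨b, rfl⟩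
  have main : ∀ r, a * a + b * b = r * r → IsSquare ((a + r) / 2) →
      ∃ x y : L, x * x - y * y = a ∧ 2 * x * y = b := by
    rintro r hr ⟨x, hx⟩
    by_cases hx0 : x = 0
    · subst hx0
      apply zero
      have : a + r = 0 := by
        field_simp at hx; linear_combination hx
      have : b * b = 0 := by
        have : r = -a := by linear_combination this
        rw [this] at hr; linear_combination hr
      simpa using this
    · have hx' : a + r = 2 * (x * x) := by field_simp at hx; linear_combination hx
      refine ⟨x, b / (2 * x), ?_, by field_simp⟩
      have : r = 2 * (x * x) - a := by linear_combination hx'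
      rw [this] at hr
      field_simp
      linear_combination -hr
  by_cases h1 : IsSquare ((a + r) / 2)
  · exact main r hr h1
  by_cases h2 : IsSquare ((a + -r) / 2)
  · exact main (-r) (by rw [hr]; ring) h2
  exfalso
  obtain ⟨s, hs⟩ := (sq _).resolve_left h1
  obtain ⟨t, ht⟩ := (sq _).resolve_left h2
  have hs0 : s ≠ 0 := by
    rintro rfl; apply h1; refine ⟨0, by linear_combination -hs⟩
  have ht0 : t ≠ 0 := by
    rintro rfl; apply h2; refine ⟨0, by linear_combination -ht⟩
  apply neg
  refine ⟨b / (2 * s * t), ?_⟩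
  have e : b * b = - (4 * (s * s) * (t * t)) := by
    have hs' : a + r = -(2 * (s * s)) := by rw [← hs]; field_simp
    have ht' : a - r = -(2 * (t * t)) := by rw [← ht]; field_simp; ring
    linear_combination hr - (a - r) * hs' + 2 * (s * s) * ht'
  field_simp
  linear_combination -e

theorem mk_rcf {L : Type*} [Field L] (sq : ∀ a : L, IsSquare a ∨ IsSquare (-a))
    (add : ∀ a b : L, IsSquare a → IsSquare b → IsSquare (a + b)) (neg : ¬ IsSquare (-1 : L))
    (hodd : ∀ p : L[X], p.Monic → Irreducible p → Odd p.natDegree → p.natDegree = 1) :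
    RCF L := by
  have hnat : ∀ n : ℕ, IsSquare (n : L) := by
    intro n
    induction n with
    | zero => exact ⟨0, by simp⟩
    | succ n ih => rw [Nat.cast_succ]; exact add _ _ ih ⟨1, by simp⟩
  have hc : CharZero L := by
    apply charZero_of_inj_zero
    intro n hn
    by_contra h0
    obtain ⟨m, rfl⟩ := Nat.exists_eq_succ_of_ne_zero h0
    apply neg
    have := hnat m
    rw [Nat.cast_succ] at hn
    rwa [eq_neg_of_add_eq_zero_left hn] at this
  have k2 : (2 : L) ≠ 0 := two_ne_zero
  refine ⟨sq, add, neg, fun p hpm hp => ?_⟩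
  let P := p * (X ^ 2 + 1)
  have hX : (X ^ 2 + 1 : L[X]) ≠ 0 := (by monicity! : (X ^ 2 + 1 : L[X]).Monic).ne_zero
  have hP0 : P ≠ 0 := mul_ne_zero hp.ne_zero hX
  let E := P.SplittingField
  have : Normal L E := Normal.of_isSplittingField P
  have : IsGalois L E := ⟨⟩
  have hsplit : (P.map (algebraMap L E)).Splits := SplittingField.splits P
  have hsp : (p.map (algebraMap L E)).Splits := hsplit.of_dvd (map_ne_zero hP0)
    (Polynomial.map_dvd _ (Dvd.intro _ rfl))
  have hsX : ((X ^ 2 + 1 : L[X]).map (algebraMap L E)).Splits := hsplit.of_dvd (map_ne_zero hP0)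
    (Polynomial.map_dvd _ (Dvd.intro_left _ rfl))
  obtain ⟨i, hi⟩ := hsX.exists_eval_eq_zero (by
    rw [degree_map]
    have : (X ^ 2 + 1 : L[X]).degree = 2 := by compute_degree!
    rw [this]; norm_num)
  have hi2 : i * i = -1 := by
    simp at hi
    linear_combination hi
  obtain ⟨m, hm⟩ := two_pow (F := L) (E := E) hodd
  let F1 : IntermediateField L E := IntermediateField.adjoin L {i}
  have hF1 : ∀ x : F1, ∃ a b : L, (x : E) = algebraMap L E a + algebraMap L E b * i := by
    rintro ⟨x, hx⟩
    have hx' : x ∈ Algebra.adjoin L {i} := by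
      rw [← IntermediateField.adjoin_simple_toSubalgebra_of_isAlgebraic
        (Algebra.IsAlgebraic.isAlgebraic i)]
      exact hx
    change ∃ a b : L, x = _
    clear hx
    induction hx' using Algebra.adjoin_induction with
    | mem x hx => rw [Set.mem_singleton_iff.1 hx]; exact ⟨0, 1, by simp⟩
    | algebraMap r => exact ⟨r, 0, by simp⟩
    | add x y _ _ h1 h2 =>
      obtain ⟨a, b, rfl⟩ := h1
      obtain ⟨c, d, rfl⟩ := h2
      exact ⟨a + c, b + d, by rw [map_add, map_add]; ring⟩
    | mul x y _ _ h1 h2 =>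
      obtain ⟨a, b, rfl⟩ := h1
      obtain ⟨c, d, rfl⟩ := h2
      refine ⟨a * c - b * d, a * d + b * c, ?_⟩
      simp only [map_add, map_sub, map_mul]
      linear_combination (algebraMap L E b * algebraMap L E d) * hi2
  have hsqF1 : ∀ x : F1, IsSquare x := by
    intro x
    obtain ⟨a, b, hab⟩ := hF1 x
    obtain ⟨c, d, h1, h2⟩ := sq_complex k2 sq add neg a b
    refine ⟨algebraMap L F1 c + algebraMap L F1 d *
      ⟨i, IntermediateField.mem_adjoin_simple_self L i⟩, ?_⟩
    apply Subtype.ext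
    rw [hab, ← h1, ← h2]
    change _ = (algebraMap L E c + algebraMap L E d * i) * (algebraMap L E c + algebraMap L E d * i)
    simp only [map_sub, map_mul, map_ofNat]
    linear_combination -(algebraMap L E d * algebraMap L E d) * hi2
  have hfr := Module.finrank_mul_finrank L F1 E
  rw [hm] at hfr
  obtain ⟨j, _, hj⟩ := (Nat.dvd_prime_pow Nat.prime_two).1 (Dvd.intro_left _ hfr)
  have hj0 : j = 0 := no_quad (F := F1) (E := E) (fun h0 => k2 (by
    apply (algebraMap L F1).injective; rw [map_ofNat, h0, map_zero])) hsqF1 hj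
  have hF1le : finrank L F1 ≤ 2 := by
    change finrank L (IntermediateField.adjoin L {i}) ≤ 2
    rw [IntermediateField.adjoin.finrank (IsIntegral.of_finite L i)]
    have h1 : minpoly L i ∣ X ^ 2 + 1 := minpoly.dvd L i (by simp [sq, hi2, pow_two])
    have := natDegree_le_of_dvd h1 hX
    have h3 : (X ^ 2 + 1 : L[X]).natDegree = 2 := by compute_degree!
    omega
  have hE : finrank L E ≤ 2 := by
    rw [hm, ← hfr, hj, hj0]; simpa using hF1le
  obtain ⟨α, hα⟩ := hsp.exists_eval_eq_zero (by
    rw [degree_map]; exact (degree_pos_of_irreducible hp).ne')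
  have hpα : p = minpoly L α := minpoly.eq_of_irreducible_of_monic hp (by
    rwa [eval_map_algebraMap] at hα) hpm
  have hdeg : p.natDegree ≤ 2 := by
    rw [hpα]; exact (minpoly.natDegree_le α).trans hE
  have hpos := hp.natDegree_pos
  have : p.natDegree = 1 ∨ p.natDegree = 2 := by omega
  have hsum := hpm.as_sum
  rcases this with hd | hd
  · left
    rw [hd] at hsum
    simp only [Finset.sum_range_succ, Finset.sum_range_zero, pow_zero, pow_one, mul_one,
      zero_add] at hsum
    exact ⟨- p.coeff 0, by rw [map_neg, sub_neg_eq_add]; exact hsum⟩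
  · right
    rw [hd] at hsum
    simp only [Finset.sum_range_succ, Finset.sum_range_zero, pow_zero, pow_one, mul_one,
      zero_add] at hsum
    set b := p.coeff 1
    set c := p.coeff 0
    have hp2 : p = (X - C (-b / 2)) ^ 2 + C (c - b ^ 2 / 4) := by
      have e1 : C b = 2 * C (b / 2) := by
        rw [show (2 : L[X]) = C 2 from rfl, ← C_mul]; congr 1; field_simp
      have e2 : C (b ^ 2 / 4) = C (b / 2) * C (b / 2) := by
        rw [← C_mul]; congr 1; field_simp; norm_num
      rw [hsum, C_sub, e2, neg_div, C_neg, e1]; ring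
    rcases sq (c - b ^ 2 / 4) with ⟨β, hβ⟩ | ⟨β, hβ⟩
    · refine ⟨-b / 2, β, ?_, by rw [pow_two β, ← hβ]; exact hp2⟩
      rintro rfl
      rw [hβ] at hp2
      have : ¬ Irreducible p := by
        rw [hp2]; simp only [mul_zero, map_zero, add_zero]
        exact not_irreducible_pow (by norm_num)
      exact this hp
    · exfalso
      have hfac : p = (X - C (-b / 2) - C β) * (X - C (-b / 2) + C β) := by
        have : c - b ^ 2 / 4 = - (β * β) := by rw [← hβ, neg_neg]
        rw [hp2, this, C_neg, C_mul]; ring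
      have d1 : (X - C (-b / 2) - C β).natDegree = 1 := by
        rw [sub_sub, ← C_add]; exact natDegree_X_sub_C _
      have d2 : (X - C (-b / 2) + C β).natDegree = 1 := by
        rw [sub_add, ← C_sub]; exact natDegree_X_sub_C _
      rcases hp.isUnit_or_isUnit hfac with hu | hu
      · have := natDegree_eq_zero_of_isUnit hu; omega
      · have := natDegree_eq_zero_of_isUnit hu; omega
end Part8

section Part9
open Matrix TensorProduct

def Hyp2 {A : Type*} [Ring A] (σ : A → A) : Prop :=
  ∃ k : ℕ, ∃ u : Matrix (Fin (2 ^ k)) (Fin (2 ^ k)) A, u * u = 1 ∧ conjT σ u = - u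

theorem Hyp2.map {A B : Type*} [Ring A] [Ring B] {σ : A → A} {τ : B → B} (h : Hyp2 σ)
    (f : A →+* B) (hf : ∀ x, f (σ x) = τ (f x)) : Hyp2 τ := by
  obtain ⟨k, u, h1, h2⟩ := h
  refine ⟨k, u.map f, ?_, ?_⟩
  · rw [← Matrix.map_mul, h1]; simp
  · ext i j
    have := congrFun (congrFun h2 i) j
    rw [conjT_apply] at this
    simp only [conjT_apply, Matrix.map_apply, Matrix.neg_apply] at this ⊢
    rw [← hf, this, map_neg]

theorem Hyp2.of_hypG {K A : Type*} [Field K] [Ring A] [Algebra K A] {σ : A → A} {k : ℕ}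
    {ι : Type*} [Fintype ι] [DecidableEq ι]
    (h : HypG (K := K) σ (1 : Matrix ι ι K)) (e : Fin (2 ^ k) ≃ ι) : Hyp2 σ :=
  ⟨k, hypG_one_iff.1 (h.one_of_equiv e)⟩

section
variable {K A : Type*} [Field K] [Ring A] [Algebra K A] {σ : A → A} 
variable {ι κ μ : Type*} [Fintype ι] [DecidableEq ι] [Fintype κ] [DecidableEq κ]
  [Fintype μ] [DecidableEq μ]

theorem blockDiagonal_symm {G : Matrix ι ι K} (hG : Gᵀ = G) :
    (blockDiagonal fun _ : μ => G)ᵀ = blockDiagonal fun _ : μ => G := by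
  rw [blockDiagonal_transpose, hG]

theorem blockDiagonal_det {G : Matrix ι ι K} (hG : IsUnit G.det) :
    IsUnit (blockDiagonal fun _ : μ => G).det := by
  rw [det_blockDiagonal]; simp [hG.ne_zero]

theorem HypG.cancelBlock [FiniteDimensional K A] (k2 : (2 : K) ≠ 0) (h : IsInvo σ)
    (hs : ∀ (c : K) x, σ (c • x) = c • σ x) {G : Matrix ι ι K} {H : Matrix κ κ K}
    (hGT : Gᵀ = G) (hHT : Hᵀ = H) (hGu : IsUnit G.det) (hHu : IsUnit H.det)
    (hGH : HypG σ (blockDiagonal fun _ : μ => fromBlocks G 0 0 H)) (hH : HypG σ H) :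
    HypG σ (blockDiagonal fun _ : μ => G) := by
  have h1 := hGH.reindex (Equiv.sumProdDistrib ι κ μ).symm
  have e : (blockDiagonal fun _ : μ => fromBlocks G 0 0 H).submatrix
      (Equiv.sumProdDistrib ι κ μ).symm (Equiv.sumProdDistrib ι κ μ).symm =
      fromBlocks (blockDiagonal fun _ : μ => G) 0 0 (blockDiagonal fun _ : μ => H) := by
    ext (⟨i, a⟩ | ⟨i, a⟩) (⟨j, b⟩ | ⟨j, b⟩) <;> simp [blockDiagonal_apply]
  rw [e] at h1
  exact HypG.cancel k2 h hs (blockDiagonal_symm hGT) (blockDiagonal_symm hHT)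
    (blockDiagonal_det hGu) (blockDiagonal_det hHu) h1 (hH.blockDiag h)

theorem HypG.sumBlock (h : IsInvo σ) {G : Matrix ι ι K} {H : Matrix κ κ K}
    (hG : HypG σ (blockDiagonal fun _ : μ => G)) (hH : HypG σ (blockDiagonal fun _ : μ => H)) :
    HypG σ (blockDiagonal fun _ : μ => fromBlocks G 0 0 H) := by
  have h1 := (hG.sum h hH).reindex (Equiv.sumProdDistrib ι κ μ)
  convert h1 using 1
  ext ⟨i | i, a⟩ ⟨j | j, b⟩ <;> simp [blockDiagonal_apply]

theorem HypG.reindexBlock {G : Matrix ι ι K} 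
    (hG : HypG σ (blockDiagonal fun _ : μ => G)) (e : κ ≃ ι) :
    HypG σ (blockDiagonal fun _ : μ => G.submatrix e e) := by
  have h1 := hG.reindex (Equiv.prodCongr e (Equiv.refl μ))
  convert h1 using 1
  ext ⟨i, a⟩ ⟨j, b⟩; simp [blockDiagonal_apply]

theorem HypG.growBlock (h : IsInvo σ) {G : Matrix ι ι K} {k l : ℕ}
    (hG : HypG σ (blockDiagonal fun _ : Fin (2 ^ k) => G)) :
    HypG σ (blockDiagonal fun _ : Fin (2 ^ (k + l)) => G) := by
  have h1 := hG.blockDiag h (κ := Fin (2 ^ l))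
  let e : Fin (2 ^ (k + l)) ≃ Fin (2 ^ k) × Fin (2 ^ l) :=
    (finCongr (pow_add 2 k l)).trans finProdFinEquiv.symm
  have h2 := h1.reindex ((Equiv.prodCongr (Equiv.refl ι) e).trans (Equiv.prodAssoc _ _ _).symm)
  convert h2 using 1
  ext ⟨i, a⟩ ⟨j, b⟩
  simp only [submatrix_apply, blockDiagonal_apply]
  have : a = b ↔ (e a).1 = (e b).1 ∧ (e a).2 = (e b).2 := by
    rw [← Prod.ext_iff, e.injective.eq_iff]
  by_cases h1 : a = b
  · simp [h1]
  · simp only [h1, if_false]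
    rw [this] at h1
    simp only [Equiv.trans_apply, Equiv.prodCongr_apply, Prod.map, Equiv.prodAssoc_symm_apply]
    split_ifs with h2 h3
    · exact absurd ⟨h3, h2⟩ h1
    · rfl
    · rfl

theorem blockDiagonal_unit (N : ℕ)
    (h : HypG (K := K) σ (blockDiagonal fun _ : Fin N => (1 : Matrix ι ι K))) :
    HypG (K := K) σ (1 : Matrix (ι × Fin N) (ι × Fin N) K) := by
  have e : (blockDiagonal fun _ : Fin N => (1 : Matrix ι ι K)) = 1 := blockDiagonal_one
  rwa [e] at h

/-- a metabolic block is hyperbolic -/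
theorem metabolic (h : IsInvo σ) (hs : ∀ (c : K) x, σ (c • x) = c • σ x)
    {B D : Matrix ι ι K} (hB : IsUnit B.det) (hD : Dᵀ = D) :
    HypG σ (fromBlocks 0 B Bᵀ D) ∧ IsUnit (fromBlocks 0 B Bᵀ D).det := by
  have hBt : IsUnit Bᵀ.det := by rwa [det_transpose]
  have e1 : Bᵀ * Bᵀ⁻¹ = 1 := Matrix.mul_nonsing_inv _ hBt
  have e2 : B⁻¹ * B = 1 := Matrix.nonsing_inv_mul _ hB
  have e3 : B * B⁻¹ = 1 := Matrix.mul_nonsing_inv _ hB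
  have e4 : (Bᵀ⁻¹ * D)ᵀ * B = D := by
    rw [transpose_mul, hD, transpose_nonsing_inv, transpose_transpose, mul_assoc, e2, mul_one]
  have e5 : Bᵀ * (Bᵀ⁻¹ * D) = D := by rw [← mul_assoc, e1, one_mul]
  constructor
  · apply HypG.of_field h hs (u := fromBlocks 1 (Bᵀ⁻¹ * D) 0 (-1))
    · simp [fromBlocks_multiply, ← fromBlocks_one]
    · rw [fromBlocks_transpose, fromBlocks_multiply, fromBlocks_multiply, fromBlocks_neg, e4, e5]
      simp
  · apply Matrix.isUnit_det_of_right_inverse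
      (B := fromBlocks (-(Bᵀ⁻¹ * D * B⁻¹)) Bᵀ⁻¹ B⁻¹ 0)
    rw [fromBlocks_multiply, ← fromBlocks_one]
    simp only [mul_neg, ← mul_assoc, e1, e3]
    simp
end

section
variable {K A : Type*} [Field K] [Ring A] [Algebra K A]

theorem bc_invo {s : A →ₗ[K] A} (h : IsInvo s) (F : Type*) [Field F] [Algebra K F] :
    IsInvo (s.baseChange F : F ⊗[K] A → F ⊗[K] A) where
  add x y := map_add _ x y
  mul x y := by
    induction x with
    | zero => simp
    | add x y hx hy => rw [add_mul, map_add, hx, hy, map_add, mul_add]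
    | tmul f a =>
      induction y with
      | zero => simp
      | add x y hx hy => rw [mul_add, map_add, hx, hy, map_add, add_mul]
      | tmul g b => simp [h.mul, mul_comm]
  inv x := by
    induction x with
    | zero => simp
    | add x y hx hy => rw [map_add, map_add, hx, hy]
    | tmul f a => simp [h.inv]

variable {F E : Type*} [Field F] [Field E] [Algebra K F] [Algebra K E] [Algebra F E]
  [IsScalarTower K F E] {κ : Type*} [Fintype κ] [DecidableEq κ]

theorem psi_comm (b : Basis κ F E) (x : E) (y : A) : Commute
    (((Algebra.TensorProduct.includeLeft : F →ₐ[K] F ⊗[K] A).mapMatrix.comp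
      ((Algebra.leftMulMatrix b).restrictScalars K)) x)
    (((Matrix.scalarAlgHom κ K).comp
      (Algebra.TensorProduct.includeRight : A →ₐ[K] F ⊗[K] A)) y) := by
  unfold Commute SemiconjBy
  ext i j
  simp [Matrix.mul_apply, Matrix.scalar_apply, Matrix.diagonal_apply]

noncomputable def psi (A : Type*) [Ring A] [Algebra K A] (b : Basis κ F E) :
    E ⊗[K] A →ₐ[K] Matrix κ κ (F ⊗[K] A) :=
  Algebra.TensorProduct.lift
    ((Algebra.TensorProduct.includeLeft : F →ₐ[K] F ⊗[K] A).mapMatrix.comp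
      ((Algebra.leftMulMatrix b).restrictScalars K))
    ((Matrix.scalarAlgHom κ K).comp (Algebra.TensorProduct.includeRight : A →ₐ[K] F ⊗[K] A))
    (psi_comm b)

theorem psi_tmul (b : Basis κ F E) (f : E) (a : A) (i j : κ) :
    psi A b (f ⊗ₜ a) i j = (Algebra.leftMulMatrix b f i j) ⊗ₜ[K] a := by
  unfold psi
  rw [Algebra.TensorProduct.lift_tmul]
  simp [Matrix.mul_apply, Matrix.scalar_apply, Matrix.diagonal_apply]

theorem psi_rel (b : Basis κ F E) (t : E →ₗ[F] F) (s : A →ₗ[K] A) (x : E ⊗[K] A) :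
    conjT (s.baseChange F) (psi A b x) * mG (F ⊗[K] A) (Matrix.of fun i j => t (b i * b j)) =
    mG (F ⊗[K] A) (Matrix.of fun i j => t (b i * b j)) * psi A b (s.baseChange E x) := by
  induction x with
  | zero => ext i j; simp [conjT_apply, Matrix.mul_apply]
  | add x y hx hy =>
    have : conjT (s.baseChange F) (psi A b (x + y)) =
      conjT (s.baseChange F) (psi A b x) + conjT (s.baseChange F) (psi A b y) := by
      ext i j; simp [conjT_apply]
    rw [this, add_mul, hx, hy, map_add, map_add, mul_add]
  | tmul f a =>
    ext i j
    simp only [Matrix.mul_apply, conjT_apply, psi_tmul, LinearMap.baseChange_tmul, mG,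
      Matrix.map_apply, Matrix.of_apply, Algebra.TensorProduct.algebraMap_apply,
      Algebra.TensorProduct.tmul_mul_tmul, one_mul, mul_one, ← TensorProduct.sum_tmul]
    congr 1
    have key : ∀ j, ∑ x, Algebra.leftMulMatrix b f x j • b x = f * b j := by
      intro j
      rw [← b.sum_repr (f * b j)]
      simp [Algebra.leftMulMatrix_eq_repr_mul]
    have l : ∑ x, Algebra.leftMulMatrix b f x i * t (b x * b j) = t (f * b i * b j) := by
      rw [← key i, Finset.sum_mul, map_sum]; simp
    have r : ∑ x, t (b i * b x) * Algebra.leftMulMatrix b f x j = t (b i * (f * b j)) := by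
      rw [← key j, Finset.mul_sum, map_sum]; simp [mul_comm]
    simp only [Algebra.algebraMap_self, RingHom.id_apply]
    rw [l, r]; congr 1; ring

theorem transfer2 (b : Basis κ F E) (t : E →ₗ[F] F) (s : A →ₗ[K] A)
    (hE : Hyp2 (s.baseChange E : E ⊗[K] A → E ⊗[K] A)) :
    ∃ k : ℕ, HypG (K := F) (s.baseChange F : F ⊗[K] A → F ⊗[K] A)
      (blockDiagonal fun _ : Fin (2 ^ k) => (Matrix.of fun i j => t (b i * b j))) := by
  obtain ⟨k, u, h1, h2⟩ := hE
  refine ⟨k, ?_⟩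
  exact HypG.transfer (psi A b).toRingHom (Matrix.of fun i j => t (b i * b j))
    (fun x => psi_rel b t s x) h1 h2
end
end Part9

section Part10
open Matrix TensorProduct Polynomial

section
variable {K A : Type*} [Field K] [Ring A] [Algebra K A] {F : Type*} [Field F] [Algebra K F]

theorem root_transfer (s : A →ₗ[K] A) (p : F[X]) [hp : Fact (Irreducible p)] (hm : p.Monic)
    (hd : 1 < p.natDegree)
    (hE : Hyp2 (s.baseChange (AdjoinRoot p) : AdjoinRoot p ⊗[K] A → AdjoinRoot p ⊗[K] A)) :
    ∃ T : ℕ → F, T 0 = 1 ∧ (∀ n, 0 < n → n < p.natDegree → T n = 0) ∧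
      T p.natDegree = - p.coeff 0 ∧
      ∀ (κ : Type) [Fintype κ] [DecidableEq κ] (e : κ ≃ Fin p.natDegree),
        ∃ k : ℕ, HypG (K := F) (s.baseChange F : F ⊗[K] A → F ⊗[K] A)
          (blockDiagonal fun _ : Fin (2 ^ k) =>
            (Matrix.of fun i j : κ => T ((e i : ℕ) + (e j : ℕ)))) := by
  have hp0 : p ≠ 0 := hp.out.ne_zero
  let pb := AdjoinRoot.powerBasis hp0
  have hdim : pb.dim = p.natDegree := AdjoinRoot.powerBasis_dim hp0
  have hgen : pb.gen = AdjoinRoot.root p := AdjoinRoot.powerBasis_gen hp0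
  let b : Basis (Fin p.natDegree) F (AdjoinRoot p) := pb.basis.reindex (finCongr hdim)
  have hb : ∀ i, b i = AdjoinRoot.root p ^ (i : ℕ) := by
    intro i
    simp [b, pb.basis_eq_pow, hgen]
  let t : AdjoinRoot p →ₗ[F] F := b.coord ⟨0, by omega⟩
  have hT0 : t (AdjoinRoot.root p ^ 0) = 1 := by
    have := hb ⟨0, by omega⟩
    simp only at this
    rw [← this]; simp [t]
  have hT : ∀ n, 0 < n → n < p.natDegree → t (AdjoinRoot.root p ^ n) = 0 := by
    intro n h0 hn
    have := hb ⟨n, hn⟩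
    simp only at this
    rw [← this]; simp [t, Finsupp.single_apply]; omega
  refine ⟨fun n => t (AdjoinRoot.root p ^ n), hT0, hT, ?_, ?_⟩
  · have h1 : aeval (AdjoinRoot.root p) p = 0 := by
      rw [AdjoinRoot.aeval_eq, AdjoinRoot.mk_self]
    rw [aeval_eq_sum_range, Finset.sum_range_succ, hm.coeff_natDegree, one_smul] at h1
    have h2 := congrArg t h1
    rw [map_add, map_sum, map_zero, Finset.sum_eq_single 0] at h2
    · rw [map_smul, hT0, smul_eq_mul, mul_one] at h2
      simp only
      linear_combination h2
    · intro i hi h0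
      rw [map_smul, hT i (by omega) (Finset.mem_range.1 hi), smul_zero]
    · intro h; exact absurd (Finset.mem_range.2 (by omega)) h
  · intro κ _ _ e
    obtain ⟨k, hk⟩ := transfer2 (b.reindex e.symm) t s hE
    refine ⟨k, ?_⟩
    convert hk using 4
    simp [hb, pow_add]

variable [FiniteDimensional K A]

theorem max_rcf (k2 : (2 : F) ≠ 0) {s : A →ₗ[K] A} (h : IsInvo s)
    (hno : ¬ Hyp2 (s.baseChange F : F ⊗[K] A → F ⊗[K] A))
    (hmax : ∀ (p : F[X]) [Fact (Irreducible p)], 1 < p.natDegree →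
      Hyp2 (s.baseChange (AdjoinRoot p) : AdjoinRoot p ⊗[K] A → AdjoinRoot p ⊗[K] A)) :
    RCF F := by
  have hF := bc_invo h F
  have hsF : ∀ (c : F) x, s.baseChange F (c • x) = c • s.baseChange F x := fun c x => map_smul _ c x
  have quad : ∀ a : F, ¬ IsSquare a → ∃ k : ℕ, HypG (K := F)
      (s.baseChange F : F ⊗[K] A → F ⊗[K] A) (blockDiagonal fun _ : Fin (2 ^ k) =>
        (fromBlocks 1 0 0 (diagonal fun _ => a) : Matrix (Unit ⊕ Unit) (Unit ⊕ Unit) F)) := by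
    intro a ha
    have hirr : Irreducible (X ^ 2 - C a : F[X]) :=
      X_pow_sub_C_irreducible_of_prime Nat.prime_two (by
        intro b hb; exact ha ⟨b, by rw [← hb, pow_two]⟩)
    have hdeg : (X ^ 2 - C a : F[X]).natDegree = 2 := natDegree_X_pow_sub_C
    have : Fact (Irreducible (X ^ 2 - C a : F[X])) := ⟨hirr⟩
    obtain ⟨T, h0, h1, h2, h3⟩ := root_transfer s (X ^ 2 - C a : F[X])
      (monic_X_pow_sub_C a (by norm_num)) (by omega) (hmax _ (by omega))
    rw [hdeg] at h1 h2
    let f : Unit ⊕ Unit → Fin (X ^ 2 - C a : F[X]).natDegree :=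
      Sum.elim (fun _ => ⟨0, by omega⟩) (fun _ => ⟨1, by omega⟩)
    have hf : Function.Bijective f := by
      rw [Fintype.bijective_iff_injective_and_card]
      constructor
      · rintro (x | x) (y | y) hxy <;> simp [f] at hxy ⊢
      · simp [hdeg]
    let e := Equiv.ofBijective f hf
    obtain ⟨k, hk⟩ := h3 _ e
    refine ⟨k, ?_⟩
    convert hk using 3
    have e0 : ∀ x, (e (Sum.inl x) : ℕ) = 0 := fun x => by simp [e, f]
    have e1 : ∀ x, (e (Sum.inr x) : ℕ) = 1 := fun x => by simp [e, f]
    ext (x | x) (y | y) <;> simp only [Matrix.of_apply, e0, e1]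
    · simp [h0]
    · simp [h1]
    · simp [h1]
    · simp [h2]
  have sq : ∀ a : F, IsSquare a ∨ IsSquare (-a) := by
    intro a
    by_contra! hcon
    obtain ⟨ha, hb⟩ := hcon
    have ha0 : a ≠ 0 := by rintro rfl; exact ha ⟨0, by simp⟩
    obtain ⟨k, hk⟩ := quad a ha
    obtain ⟨l, hl⟩ := quad (-a) hb
    have hk' := hk.growBlock hF (l := l)
    have hl' := hl.growBlock hF (l := k)
    rw [add_comm l k] at hl'
    have h1 := (hk'.sumBlock hF hl').reindexBlock (Equiv.sumSumSumComm Unit Unit Unit Unit)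
    have h2 : (fromBlocks (fromBlocks 1 0 0 (diagonal fun _ => a) : Matrix (Unit ⊕ Unit) _ F) 0 0
        (fromBlocks 1 0 0 (diagonal fun _ => -a))).submatrix
        (Equiv.sumSumSumComm Unit Unit Unit Unit) (Equiv.sumSumSumComm Unit Unit Unit Unit) =
        fromBlocks (1 : Matrix (Unit ⊕ Unit) (Unit ⊕ Unit) F) 0 0
          (diagonal (Sum.elim (fun _ => a) (fun _ => -a))) := by
      ext ((x | x) | (x | x)) ((y | y) | (y | y)) <;> simp [Matrix.one_apply]
    rw [h2] at h1
    have h3 : HypG (K := F) (s.baseChange F : F ⊗[K] A → F ⊗[K] A)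
        (diagonal (Sum.elim (fun _ => a) (fun _ => -a)) : Matrix (Unit ⊕ Unit) (Unit ⊕ Unit) F) := by
      apply HypG.of_field hF hsF (u := fromBlocks 0 1 1 0)
      · simp [fromBlocks_multiply]
      · ext (x | x) (y | y) <;> simp [Matrix.mul_apply, Matrix.diagonal_apply]
    have h4 := HypG.cancelBlock k2 hF hsF (by simp) (by simp) (by simp)
      (by simp [ha0]) h1 h3
    have h5 := blockDiagonal_unit _ h4
    apply hno
    exact Hyp2.of_hypG (k := k + l + 1) h5 (Fintype.equivOfCardEq (by simp [pow_succ, mul_comm]))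
  have neg2 : ∀ x y : F, x * x + y * y ≠ -1 := by
    intro x y hxy
    apply hno
    have : HypG (K := F) (s.baseChange F : F ⊗[K] A → F ⊗[K] A) (1 : Matrix (Fin 4) (Fin 4) F) := by
      apply HypG.of_field hF hsF (u := !![0, -x, -y, 0; x, 0, 0, y; y, 0, 0, -x; 0, -y, x, 0])
      · ext i j
        fin_cases i <;> fin_cases j <;> simp [Matrix.mul_apply, Fin.sum_univ_four] <;>
          first | ring1 | linear_combination -hxy
      · ext i j
        fin_cases i <;> fin_cases j <;> simp
    exact Hyp2.of_hypG (k := 2) this (Equiv.refl _)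
  have neg : ¬ IsSquare (-1 : F) := by
    rintro ⟨x, hx⟩; exact neg2 x 0 (by rw [hx]; ring)
  have add : ∀ a b : F, IsSquare a → IsSquare b → IsSquare (a + b) := by
    rintro _ _ ⟨x, rfl⟩ ⟨y, rfl⟩
    rcases sq (x * x + y * y) with h | ⟨z, hz⟩
    · exact h
    · by_cases hz0 : z = 0
      · exact ⟨0, by rw [hz0] at hz; linear_combination -hz⟩
      · exfalso; apply neg2 (x / z) (y / z); field_simp; linear_combination -hz
  apply mk_rcf sq add neg
  intro p hm hp hodd
  by_contra hne
  obtain ⟨m, hd⟩ := hodd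
  have hm0 : 0 < m := by omega
  have : Fact (Irreducible p) := ⟨hp⟩
  obtain ⟨T, h0, h1, h2, h3⟩ := root_transfer s p hm (by omega) (hmax _ (by omega))
  have hc : p.coeff 0 ≠ 0 := by
    intro hc
    have := (Polynomial.X_dvd_iff.2 hc)
    obtain ⟨q, hq⟩ := this
    rcases hp.isUnit_or_isUnit hq with h | h
    · exact Polynomial.not_isUnit_X h
    · have := Polynomial.natDegree_eq_zero_of_isUnit h
      have h5 := congrArg natDegree hq
      rw [natDegree_X_mul (by rintro rfl; simp at h)] at h5
      omega
  let f : Unit ⊕ (Fin m ⊕ Fin m) → Fin p.natDegree :=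
    Sum.elim (fun _ => ⟨0, by omega⟩)
      (Sum.elim (fun i => ⟨i + 1, by omega⟩) (fun j => ⟨2 * m - j, by omega⟩))
  have hf : Function.Bijective f := by
    rw [Fintype.bijective_iff_injective_and_card]
    constructor
    · rintro (x | x | x) (y | y | y) hxy <;> simp [f] at hxy ⊢ <;> omega
    · simp [hd]; omega
  obtain ⟨k, hk⟩ := h3 _ (Equiv.ofBijective f hf)
  let B : Matrix (Fin m) (Fin m) F := Matrix.of fun i j => T (i + 1 + (2 * m - j))
  let D : Matrix (Fin m) (Fin m) F := Matrix.of fun i j => T ((2 * m - i) + (2 * m - j))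
  have hB : IsUnit B.det := by
    rw [det_of_lowerTriangular]
    · have : ∀ i, B i i = - p.coeff 0 := by
        intro i
        simp only [B, Matrix.of_apply]
        rw [← h2, hd]; congr 1; omega
      simp [this, hc]
    · intro i j hij
      have hij : i < j := hij
      simp only [B, Matrix.of_apply]
      apply h1 <;> omega
  have hD : Dᵀ = D := by ext i j; simp [D, add_comm]
  obtain ⟨h4, h5⟩ := metabolic hF hsF hB hD
  have h6 : (Matrix.of fun i j => T ((Equiv.ofBijective f hf i : ℕ) + (Equiv.ofBijective f hf j : ℕ)))
      = fromBlocks 1 0 0 (fromBlocks 0 B Bᵀ D) := by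
    ext (x | x | x) (y | y | y) <;> simp [f, B, D]
    · exact h0
    · apply h1 <;> omega
    · apply h1 <;> omega
    · apply h1 <;> omega
    · apply h1 <;> omega
    · apply h1 <;> omega
    · congr 1; omega
  rw [h6] at hk
  have h7 := HypG.cancelBlock k2 hF hsF (by simp) (by simp [fromBlocks_transpose, hD]) (by simp)
      h5 hk h4
  exact hno (Hyp2.of_hypG (k := k) (blockDiagonal_unit _ h7) (Fintype.equivOfCardEq (by simp)))
end
end Part10

section Part11
open Matrix TensorProduct Polynomial

section
variable {K A : Type*} [Field K] [Ring A] [Algebra K A]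

noncomputable def bMap (A : Type*) [Ring A] [Algebra K A] {E E' : Type*} [Field E] [Field E']
    [Algebra K E] [Algebra K E'] (f : E →ₐ[K] E') : E ⊗[K] A →+* E' ⊗[K] A :=
  (Algebra.TensorProduct.map f (AlgHom.id K A)).toRingHom

variable {E E' : Type*} [Field E] [Field E'] [Algebra K E] [Algebra K E']

theorem bMap_tmul (f : E →ₐ[K] E') (x : E) (a : A) : bMap A f (x ⊗ₜ a) = f x ⊗ₜ[K] a := by
  simp [bMap]

theorem bMap_comm (f : E →ₐ[K] E') (s : A →ₗ[K] A) (x : E ⊗[K] A) :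
    bMap A f (s.baseChange E x) = s.baseChange E' (bMap A f x) := by
  induction x with
  | zero => simp
  | add x y hx hy => simp only [map_add, hx, hy]
  | tmul e a => simp only [LinearMap.baseChange_tmul, bMap_tmul]

theorem bMap_inj (f : E →ₐ[K] E') : Function.Injective (bMap A f) := by
  have h := Module.Flat.rTensor_preserves_injective_linearMap (M := A) f.toLinearMap
    f.toRingHom.injective
  have e : ∀ x, bMap A f x = f.toLinearMap.rTensor A x := by
    intro x
    induction x with
    | zero => simp
    | add x y hx hy => simp only [map_add, hx, hy]
    | tmul e a => simp only [LinearMap.rTensor_tmul, bMap_tmul]; rfl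
  intro x y hxy
  rw [e, e] at hxy
  exact h hxy

theorem Hyp2.bMap {s : A →ₗ[K] A} (h : Hyp2 (s.baseChange E : E ⊗[K] A → E ⊗[K] A))
    (f : E →ₐ[K] E') : Hyp2 (s.baseChange E' : E' ⊗[K] A → E' ⊗[K] A) :=
  h.map (_root_.bMap A f) (bMap_comm f s)

variable {Ω : Type*} [Field Ω] [Algebra K Ω]

theorem bMap_incl_trans {L M N : IntermediateField K Ω} (h1 : L ≤ M) (h2 : M ≤ N)
    (x : L ⊗[K] A) : bMap A (IntermediateField.inclusion h2)
      (bMap A (IntermediateField.inclusion h1) x) =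
      bMap A (IntermediateField.inclusion (h1.trans h2)) x := by
  induction x with
  | zero => simp
  | add x y hx hy => simp only [map_add, hx, hy]
  | tmul e a => simp only [bMap_tmul]; rfl

theorem chain_desc (s : A →ₗ[K] A) (c : Set (IntermediateField K Ω)) (hc : DirectedOn (· ≤ ·) c)
    (hne : c.Nonempty)
    (h : Hyp2 (s.baseChange ↥(sSup c) : ↥(sSup c) ⊗[K] A → ↥(sSup c) ⊗[K] A)) :
    ∃ M ∈ c, Hyp2 (s.baseChange M : M ⊗[K] A → M ⊗[K] A) := by
  have hle : ∀ M : c, M.1 ≤ sSup c := fun M => le_sSup M.2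
  have hcd : Directed (· ≤ ·) (fun M : c => M.1) := directedOn_iff_directed.1 hc
  have hne' : Nonempty c := hne.to_subtype
  have hsup : ∀ x : Ω, x ∈ sSup c → ∃ M, ∃ _ : M ∈ c, x ∈ M := by
    intro x hx
    rwa [sSup_eq_iSup', ← SetLike.mem_coe, IntermediateField.coe_iSup_of_directed hc.directed_val,
      Set.mem_iUnion, Subtype.exists] at hx
  have key : ∀ x : ↥(sSup c) ⊗[K] A, ∃ M : c, ∃ y : M.1 ⊗[K] A,
      bMap A (IntermediateField.inclusion (hle M)) y = x := by
    intro x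
    induction x with
    | zero => exact ⟨hne'.some, 0, map_zero _⟩
    | tmul f a =>
      obtain ⟨M, hM, hf⟩ := hsup f f.2
      exact ⟨⟨M, hM⟩, ⟨f, hf⟩ ⊗ₜ a, by rw [bMap_tmul]; rfl⟩
    | add x y hx hy =>
      obtain ⟨M, x', rfl⟩ := hx
      obtain ⟨N, y', rfl⟩ := hy
      obtain ⟨R, h1, h2⟩ := hcd M N
      refine ⟨R, bMap A (IntermediateField.inclusion h1) x' +
        bMap A (IntermediateField.inclusion h2) y', ?_⟩
      rw [map_add, bMap_incl_trans, bMap_incl_trans]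
  obtain ⟨k, u, hu1, hu2⟩ := h
  choose M y hy using key
  obtain ⟨R, hR⟩ := hcd.finite_le
    (fun ij : Fin (2 ^ k) × Fin (2 ^ k) => M (u ij.1 ij.2))
  refine ⟨R.1, R.2, k, Matrix.of fun i j =>
    bMap A (IntermediateField.inclusion (hR (i, j))) (y (u i j)), ?_, ?_⟩
  all_goals
    set v : Matrix (Fin (2 ^ k)) (Fin (2 ^ k)) (R.1 ⊗[K] A) := Matrix.of fun i j =>
      bMap A (IntermediateField.inclusion (hR (i, j))) (y (u i j)) with hv
    let φ := bMap A (IntermediateField.inclusion (hle R))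
    have hφ : Function.Injective φ := bMap_inj _
    have hvu : v.map φ = u := by
      ext i j
      simp only [hv, Matrix.map_apply, Matrix.of_apply, φ]
      rw [bMap_incl_trans, hy]
  · apply Matrix.map_injective hφ
    simp only
    rw [Matrix.map_mul, hvu, hu1]; simp
  · ext i j
    apply hφ
    have h2 := congrFun (congrFun hu2 i) j
    rw [conjT_apply, ← hvu] at h2
    simp only [conjT_apply, Matrix.neg_apply, Matrix.map_apply] at h2 ⊢
    rw [map_neg, ← h2]
    exact bMap_comm _ s _

theorem exists_max_field (s : A →ₗ[K] A) (hno : ¬ Hyp2 s) [IsAlgClosed Ω] :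
    ∃ L : IntermediateField K Ω, ¬ Hyp2 (s.baseChange L : L ⊗[K] A → L ⊗[K] A) ∧
      ∀ (p : L[X]) [Fact (Irreducible p)], 1 < p.natDegree →
      Hyp2 (s.baseChange (AdjoinRoot p) : AdjoinRoot p ⊗[K] A → AdjoinRoot p ⊗[K] A) := by
  have hbot : ¬ Hyp2 (s.baseChange (⊥ : IntermediateField K Ω) :
      (⊥ : IntermediateField K Ω) ⊗[K] A → (⊥ : IntermediateField K Ω) ⊗[K] A) := by
    intro h
    have h1 := h.bMap (IntermediateField.botEquiv K Ω).toAlgHom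
    apply hno
    apply h1.map (Algebra.TensorProduct.lid K A).toRingHom
    intro x
    induction x with
    | zero => simp
    | add x y hx hy => simp only [map_add, hx, hy]
    | tmul e a => simp
  obtain ⟨L, -, hL⟩ := zorn_le_nonempty₀
    {L : IntermediateField K Ω | ¬ Hyp2 (s.baseChange L : L ⊗[K] A → L ⊗[K] A)} (by
      intro c hcS hc M hM
      refine ⟨sSup c, ?_, fun z hz => le_sSup hz⟩
      intro h
      obtain ⟨N, hN, hN2⟩ := chain_desc s c hc.directedOn ⟨M, hM⟩ h
      exact hcS hN hN2) ⊥ hbot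
  refine ⟨L, hL.prop, ?_⟩
  intro p hp hd
  obtain ⟨α, hα⟩ := IsAlgClosed.exists_aeval_eq_zero Ω p (by
    intro h0; have h1 : p.natDegree = 0 := natDegree_eq_of_degree_eq_some h0; omega)
  let φ : AdjoinRoot p →ₐ[L] Ω := AdjoinRoot.liftAlgHom p (Algebra.ofId L Ω) α (by
    simpa [aeval_def] using hα)
  let φK : AdjoinRoot p →ₐ[K] Ω := φ.restrictScalars K
  have hLE : L ≤ φK.fieldRange := by
    intro x hx
    refine ⟨algebraMap L _ ⟨x, hx⟩, ?_⟩
    exact φ.commutes ⟨x, hx⟩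
  have hαE : α ∈ φK.fieldRange := ⟨AdjoinRoot.root p, by simp [φK, φ]⟩
  by_contra hcon
  have hES : ¬ Hyp2 (s.baseChange φK.fieldRange :
      φK.fieldRange ⊗[K] A → φK.fieldRange ⊗[K] A) := by
    intro h
    exact hcon (h.bMap (AlgEquiv.ofInjectiveField φK).symm.toAlgHom)
  have hEL : φK.fieldRange ≤ L := hL.le_of_ge hES hLE
  have hαL := hEL hαE
  have hroot : p.IsRoot ⟨α, hαL⟩ := by
    have h1 : algebraMap L Ω (p.eval ⟨α, hαL⟩) = 0 := by
      rw [← hα, ← Polynomial.aeval_algebraMap_apply_eq_algebraMap_eval]; rfl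
    exact (map_eq_zero _).1 h1
  have := degree_eq_one_of_irreducible_of_root hp.out hroot
  have h1 : p.natDegree = 1 := natDegree_eq_of_degree_eq_some this
  omega
end
end Part11

section Part12
open Matrix TensorProduct Polynomial

section
variable {K A : Type*} [Field K] [Ring A] [Algebra K A] 

noncomputable def regTr (K A : Type*) [Field K] [Ring A] [Algebra K A] : A →ₗ[K] K :=
  (LinearMap.trace K A).comp (LinearMap.mul K A)

theorem form_expand {ι : Type*} [Fintype ι] (b : Basis ι K A) (s : A →ₗ[K] A) (v : A) :
    involutionTraceForm K s v =
      ∑ i, ∑ j, b.repr v i * b.repr v j * regTr K A (s (b i) * b j) := by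
  have h1 : involutionTraceForm K s v = regTr K A (s v * v) := rfl
  rw [h1]
  conv_lhs => rw [← b.sum_repr v]
  simp only [map_sum, map_smul, Finset.sum_mul_sum, smul_mul_smul_comm, smul_eq_mul]

theorem regTr_bc [FiniteDimensional K A] (F : Type*) [Field F] [Algebra K F] (a : A) :
    regTr F (F ⊗[K] A) (1 ⊗ₜ a) = algebraMap K F (regTr K A a) := by
  have h1 : LinearMap.mul F (F ⊗[K] A) (1 ⊗ₜ a) = (LinearMap.mul K A a).baseChange F := by
    ext x; simp
  change LinearMap.trace F _ (LinearMap.mul F (F ⊗[K] A) (1 ⊗ₜ a)) = _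
  rw [h1, LinearMap.trace_baseChange]; rfl

theorem form_bc [FiniteDimensional K A] (F : Type*) [Field F] [Algebra K F] (k2 : (2 : F) ≠ 0)
    {ι : Type*} [Fintype ι] (b : Basis ι K A) (s : A →ₗ[K] A) (w : ι → K)
    (hw : ∀ v, involutionTraceForm K s v = ∑ i, w i * (b.repr v i * b.repr v i))
    (v : F ⊗[K] A) : involutionTraceForm F (s.baseChange F) v =
      ∑ i, algebraMap K F (w i) * ((Algebra.TensorProduct.basis F b).repr v i *
        (Algebra.TensorProduct.basis F b).repr v i) := by
  classical
  have hd : ∀ i, regTr K A (s (b i) * b i) = w i := by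
    intro i
    have h1 : involutionTraceForm K s (b i) = regTr K A (s (b i) * b i) := rfl
    rw [← h1, hw]
    simp [Finsupp.single_apply]
  have ho : ∀ i j, i ≠ j → regTr K A (s (b i) * b j) + regTr K A (s (b j) * b i) = 0 := by
    intro i j hij
    have h1 : involutionTraceForm K s (b i + b j) =
      regTr K A (s (b i + b j) * (b i + b j)) := rfl
    rw [hw, map_add s, add_mul (s (b i)), mul_add, mul_add, map_add (regTr K A),
      map_add (regTr K A), map_add (regTr K A), hd, hd] at h1
    have h2 : ∑ k, w k * (b.repr (b i + b j) k * b.repr (b i + b j) k) = w i + w j := by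
      have : ∀ k, w k * (b.repr (b i + b j) k * b.repr (b i + b j) k) =
          (if i = k then w k else 0) + (if j = k then w k else 0) := by
        intro k
        simp only [map_add, Basis.repr_self, Finsupp.add_apply, Finsupp.single_apply]
        by_cases h3 : i = k
        · have : j ≠ k := by rintro rfl; exact hij h3
          simp [h3, this]
        · by_cases h4 : j = k <;> simp [h3, h4]
      rw [Finset.sum_congr rfl fun k _ => this k, Finset.sum_add_distrib]; simp
    rw [h2] at h1
    linear_combination -h1
  set bF := Algebra.TensorProduct.basis F b
  rw [form_expand bF (s.baseChange F) v]
  have hM : ∀ i j, regTr F (F ⊗[K] A) (s.baseChange F (bF i) * bF j) =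
      algebraMap K F (regTr K A (s (b i) * b j)) := by
    intro i j
    simp [bF, ← regTr_bc]
  simp only [hM]
  apply mul_left_cancel₀ k2
  rw [two_mul]
  conv_lhs => enter [2]; rw [Finset.sum_comm]
  rw [← Finset.sum_add_distrib, Finset.mul_sum]
  refine Finset.sum_congr rfl fun i _ => ?_
  rw [← Finset.sum_add_distrib, Finset.sum_eq_single i]
  · rw [hd]; ring
  · intro j _ hj
    have := congrArg (algebraMap K F) (ho i j hj.symm)
    rw [map_add, map_zero] at this
    linear_combination bF.repr v i * bF.repr v j * this
  · intro h; exact absurd (Finset.mem_univ _) h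

def FieldOrdering.comap {F : Type*} [Field F] [Algebra K F] (O : FieldOrdering F) :
    FieldOrdering K where
  carrier := {a | algebraMap K F a ∈ O.carrier}
  add_mem' a b ha hb := by
    simp only [Set.mem_ofPred_eq, map_add] at *; exact O.add_mem' ha hb
  mul_mem' a b ha hb := by
    simp only [Set.mem_ofPred_eq, map_mul] at *; exact O.mul_mem' ha hb
  total' a ha := by
    simp only [Set.mem_ofPred_eq, map_neg]
    exact O.total' _ ((_root_.map_ne_zero _).2 ha)
  disjoint' a ha := by
    simp only [Set.mem_ofPred_eq, map_neg] at *
    exact O.disjoint' _ ha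

theorem b_imp_a [FiniteDimensional K A] (k2 : (2 : K) ≠ 0) {s : A →ₗ[K] A} (h : IsInvo s)
    (hb : ∀ O : FieldOrdering K, signatureAt O (involutionTraceForm K s) = 0) : Hyp2 s := by
  by_contra hno
  obtain ⟨L, hL, hmax⟩ := exists_max_field (Ω := AlgebraicClosure K) s hno
  have k2L : (2 : L) ≠ 0 := by
    have := (_root_.map_ne_zero (algebraMap K L)).2 k2
    rwa [map_ofNat] at this
  have hR := max_rcf k2L h hL hmax
  obtain ⟨b, w, hw⟩ := exists_diag k2 h (fun c x => map_smul s c x)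
  have h1 := hb (hR.ordering.comap)
  rw [signatureAt_diag _ b w _ hw] at h1
  apply hL
  refine Hyp2.of_hypG (k := 1) (rc k2L hR (bc_invo h L)
    (fun c x => map_smul (s.baseChange L) c x) ?_) (Fintype.equivOfCardEq (by simp))
  rw [signatureAt_diag _ (Algebra.TensorProduct.basis L b) _ _ (form_bc L k2L b s w hw), ← h1]
  simp only [FieldOrdering.comap, Set.mem_ofPred_eq, map_neg]
end
end Part12

/-- **Theorem.** `n × (A,σ)` is hyperbolic for some `n ≥ 1` iff the involution-trace form
has signature `0` at every ordering of `K`; the minimal such `n` is a power of `2`. -/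
theorem statement7 {K A : Type*} [Field K] (hchar : (2 : K) ≠ 0)
    [Ring A] [Algebra K A] [FiniteDimensional K A]
    (σ : A → A)
    (hadd : ∀ x y : A, σ (x + y) = σ x + σ y)
    (hsmul : ∀ (c : K) (x : A), σ (c • x) = c • σ x)
    (hmul : ∀ x y : A, σ (x * y) = σ y * σ x)
    (hinvol : ∀ x : A, σ (σ x) = x) :
    ((∃ n : ℕ, 0 < n ∧ MatrixInvolutionHyperbolic σ n) ↔
      ∀ O : FieldOrdering K, signatureAt O (involutionTraceForm K σ) = 0) ∧
    ((∃ n : ℕ, 0 < n ∧ MatrixInvolutionHyperbolic σ n) →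
      ∃ k : ℕ, IsLeast {n : ℕ | 0 < n ∧ MatrixInvolutionHyperbolic σ n} (2 ^ k)) := by
  have h : IsInvo σ := ⟨hadd, hmul, hinvol⟩
  let s : A →ₗ[K] A := { toFun := σ, map_add' := hadd, map_smul' := hsmul }
  have ab : (∃ n : ℕ, 0 < n ∧ MatrixInvolutionHyperbolic σ n) →
      ∀ O : FieldOrdering K, signatureAt O (involutionTraceForm K σ) = 0 := by
    rintro ⟨n, hn, hyp⟩ O
    exact a_imp_b hchar h hsmul O hn hyp
  have ba : (∀ O : FieldOrdering K, signatureAt O (involutionTraceForm K σ) = 0) →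
      ∃ k : ℕ, MatrixInvolutionHyperbolic σ (2 ^ k) := by
    intro hb
    obtain ⟨k, hk⟩ := b_imp_a (s := s) hchar h hb
    exact ⟨k, (hyp_iff hchar _ h hsmul).2 (hypG_one_iff.2 hk)⟩
  refine ⟨⟨ab, fun hb => ?_⟩, fun ha => ?_⟩
  · obtain ⟨k, hk⟩ := ba hb
    exact ⟨2 ^ k, by positivity, hk⟩
  · obtain ⟨k, hk⟩ := ba (ab ha)
    exact pow_two_min hchar h hsmul hk
end
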